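/- arXiv:2309.17025 — 3 statements merged into one kernel-verified Lean document; each statement's English description precedes it below -/
import Mathlib

section
/- Let φ be a flag and ρ^• an increasing factorization of a reduced word. The weak Edelman–Greene recording tableau Q̂(ρ^•) is φ-flagged (every entry in its i-th row is at most φ(i)) if and only if ρ^• is φ-flagged (for each nonempty block ρ^{(i)}, its first letter ρ^{(i)}_1 satisfies φ(ρ^{(i)}_1) ≥ i). -/
noncomputable section
attribute [local instance] Classical.propDecidable

/-! ### Words, permutations, reduced words -/

/-- The adjacent transposition `s_i` exchanging `i` and `i+1`. -/
def sPerm (i : ℕ) : Equiv.Perm ℕ := Equiv.swap i (i + 1)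

/-- The permutation `s_{i_1} ⋯ s_{i_n}` represented by the word `i_1 ⋯ i_n`. -/
def wordPerm (ρ : List ℕ) : Equiv.Perm ℕ := (ρ.map sPerm).prod

/-- A word whose letters are positive integers. -/
def PosWord (ρ : List ℕ) : Prop := ∀ x ∈ ρ, 1 ≤ x

/-- A reduced word: a word of positive integers of minimal length among all words of
positive integers representing the same permutation. -/
def IsReducedWord (ρ : List ℕ) : Prop :=
  PosWord ρ ∧ ∀ σ : List ℕ, PosWord σ → wordPerm σ = wordPerm ρ → ρ.length ≤ σ.length

/-- `ρ` is a reduced word for the permutation `w`. -/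
def IsReducedWordFor (w : Equiv.Perm ℕ) (ρ : List ℕ) : Prop :=
  IsReducedWord ρ ∧ wordPerm ρ = w

/-- A member of `S∞`: a permutation of the positive integers (it fixes `0`)
fixing all but finitely many points. -/
def FinitaryPerm (w : Equiv.Perm ℕ) : Prop := w 0 = 0 ∧ {i : ℕ | w i ≠ i}.Finite

/-- A flag: a weakly increasing function `φ : ℤ_{>0} → ℤ_{>0}` with `φ(n) ≥ n`. -/
def IsFlag (φ : ℕ → ℕ) : Prop :=
  (∀ m n : ℕ, 1 ≤ m → m ≤ n → φ m ≤ φ n) ∧ ∀ n : ℕ, 1 ≤ n → n ≤ φ n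

/-- A weak composition, as a function on the positive integers (value `0` at `0`)
with finitely many nonzero entries. -/
def WeakComp (α : ℕ → ℕ) : Prop := α 0 = 0 ∧ {i : ℕ | α i ≠ 0}.Finite

/-- `φ - e_i`, i.e. `l ↦ φ(l) - δ_{il}`. -/
def subE (φ : ℕ → ℕ) (i : ℕ) : ℕ → ℕ := fun l => if l = i then φ l - 1 else φ l

/-- The right action of `s_i` on weak compositions, swapping entries `i` and `i+1`. -/
def swapC (α : ℕ → ℕ) (i : ℕ) : ℕ → ℕ := fun j => α (sPerm i j)

/-- `α` has length `k`: `k` is minimal with `α i = 0` for all `i > k`. -/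
def HasLen (α : ℕ → ℕ) (k : ℕ) : Prop :=
  (∀ i, k < i → α i = 0) ∧ ∀ m, (∀ i, m < i → α i = 0) → k ≤ m

/-! ### Coxeter–Knuth equivalence -/

/-- One Coxeter–Knuth move. -/
def CKStep (u v : List ℕ) : Prop :=
  (∃ (a b : List ℕ) (x y z : ℕ), y < x ∧ x < z ∧
      u = a ++ [x, y, z] ++ b ∧ v = a ++ [x, z, y] ++ b) ∨
  (∃ (a b : List ℕ) (x y z : ℕ), y < z ∧ z < x ∧
      u = a ++ [x, y, z] ++ b ∧ v = a ++ [y, x, z] ++ b) ∨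
  (∃ (a b : List ℕ) (i : ℕ),
      u = a ++ [i, i + 1, i] ++ b ∧ v = a ++ [i + 1, i, i + 1] ++ b)

/-- Coxeter–Knuth equivalence: the transitive (symmetric, reflexive) closure of `CKStep`. -/
def CKEquiv : List ℕ → List ℕ → Prop := Relation.EqvGen CKStep

/-! ### Run factorizations and weak descent tableaux -/

/-- The run factorization of a word into maximal strictly increasing blocks
(listed from left to right). -/
def runFact : List ℕ → List (List ℕ)
  | [] => []
  | a :: rest =>
    match runFact rest with
    | [] => [[a]]
    | r :: rs => if a < r.headI then (a :: r) :: rs else [a] :: r :: rs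

/-- Auxiliary: rows of the remaining blocks, given the row of the previous block. -/
def wdtRowsAux : ℤ → List (List ℕ) → List ℤ
  | _, [] => []
  | prev, b :: bs =>
      min (prev - 1) (b.headI : ℤ) :: wdtRowsAux (min (prev - 1) (b.headI : ℤ)) bs

/-- The row indices assigned to the blocks of a run factorization (blocks listed
left to right): the leftmost block goes to the row indexed by its first letter, and each
subsequent block goes to the row indexed by its first letter if this is below the previous
block's row, and otherwise directly below the previous block's row. -/
def wdtRows : List (List ℕ) → List ℤ
  | [] => []
  | b :: bs => (b.headI : ℤ) :: wdtRowsAux (b.headI : ℤ) bs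

/-- A tableau: rows indexed by `ℤ` (bottom to top), columns indexed by `ℕ` starting at `1`;
the value `0` means that there is no box, a nonzero value is the (positive) entry. -/
abbrev Tableau := ℤ → ℕ → ℕ

/-- The weak descent tableau of a word. -/
def weakDesTab (ρ : List ℕ) : Tableau := fun r c =>
  if c = 0 then 0
  else
    match ((wdtRows (runFact ρ)).zip (runFact ρ)).find? (fun p => decide (p.1 = r)) with
    | some p => p.2.getD (c - 1) 0
    | none => 0

/-- A word is non-virtual if its weak descent tableau only occupies rows of positive index. -/
def NonVirtual (ρ : List ℕ) : Prop := ∀ r ∈ wdtRows (runFact ρ), 1 ≤ r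

/-- The shape of a tableau: the number of boxes in each (positively indexed) row. -/
def shapeOf (T : Tableau) : ℕ → ℕ := fun i => Set.ncard {c : ℕ | T (i : ℤ) c ≠ 0}

/-- The weak descent composition of a word: the shape of its weak descent tableau. -/
def desComp (ρ : List ℕ) : ℕ → ℕ := shapeOf (weakDesTab ρ)

/-- Partial-sum (dominance) order on weak compositions. -/
def compLE (μ ν : ℕ → ℕ) : Prop :=
  ∀ k : ℕ, ∑ i ∈ Finset.Icc 1 k, μ i ≤ ∑ i ∈ Finset.Icc 1 k, ν i

/-- A Yamanouchi reduced word: a non-virtual reduced word that is minimal in its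
Coxeter–Knuth class among non-virtual words, for the order
`ρ ≤ τ ↔ ρ ~ τ ∧ des ρ ≤ des τ`. -/
def Yamanouchi (ρ : List ℕ) : Prop :=
  IsReducedWord ρ ∧ NonVirtual ρ ∧
    ∀ σ : List ℕ, NonVirtual σ → CKEquiv ρ σ → compLE (desComp ρ) (desComp σ)

/-- The (unique) Yamanouchi reduced word Coxeter–Knuth equivalent to `ρ`. -/
def hatRho (ρ : List ℕ) : List ℕ :=
  if h : ∃ σ, Yamanouchi σ ∧ CKEquiv ρ σ then h.choose else []

/-- The weak Edelman–Greene insertion tableau of a word: the weak descent tableau of the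
unique Yamanouchi reduced word Coxeter–Knuth equivalent to it. -/
def hatP (ρ : List ℕ) : Tableau := weakDesTab (hatRho ρ)

/-! ### Factorizations -/

/-- The factorization `f : ℕ → List ℕ` stores the block `ρ^{(i)}` at index `i ≥ 1`
(blocks indexed from the right); the largest index of a nonempty block. -/
def topIdx (f : ℕ → List ℕ) : ℕ := sSup {i : ℕ | f i ≠ []}

/-- The concatenation `ρ^{(top)} ⋯ ρ^{(i+1)} ρ^{(i)}` of the blocks of `f` with index `≥ i`. -/
def factWordGe (f : ℕ → List ℕ) (i : ℕ) : List ℕ :=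
  ((((List.range (topIdx f + 1)).reverse).filter (fun j => decide (i ≤ j))).map f).foldr
    (· ++ ·) []

/-- The underlying word of a factorization. -/
def factWord (f : ℕ → List ℕ) : List ℕ := factWordGe f 0

/-- The weak Edelman–Greene recording tableau of a factorization: it has the same shape as
the weak EG insertion tableau of the underlying word, and has entry `i` in all boxes of
`P̂(ρ^{(k)}|⋯|ρ^{(i)})` that are not in `P̂(ρ^{(k)}|⋯|ρ^{(i+1)})`. -/
def hatQfact (f : ℕ → List ℕ) : Tableau := fun r c =>
  sSup {i : ℕ | 1 ≤ i ∧ hatP (factWordGe f i) r c ≠ 0 ∧ hatP (factWordGe f (i + 1)) r c = 0}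

/-- Every block is strictly increasing. -/
def IncreasingFact (f : ℕ → List ℕ) : Prop := ∀ i, List.Chain' (· < ·) (f i)

/-- The factorization is `φ`-flagged: every nonempty block `ρ^{(i)}` has first letter
`ρ^{(i)}_1` with `φ(ρ^{(i)}_1) ≥ i`. -/
def FlaggedFact (φ : ℕ → ℕ) (f : ℕ → List ℕ) : Prop :=
  ∀ i, f i ≠ [] → i ≤ φ ((f i).headI)

/-- `RFC(w, φ)`: all `φ`-flagged increasing factorizations of reduced words for `w`. -/
def RFCset (w : Equiv.Perm ℕ) (φ : ℕ → ℕ) : Set (ℕ → List ℕ) :=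
  {f | f 0 = [] ∧ {i : ℕ | f i ≠ []}.Finite ∧ IncreasingFact f ∧ FlaggedFact φ f ∧
       IsReducedWordFor w (factWord f)}

/-- `RF_n(w)`: increasing factorizations of reduced words for `w` with exactly `n` blocks
(indexed `1, …, n`, possibly empty). -/
def RFn (n : ℕ) (w : Equiv.Perm ℕ) : Set (ℕ → List ℕ) :=
  {f | f 0 = [] ∧ (∀ j, n < j → f j = []) ∧ IncreasingFact f ∧
       IsReducedWordFor w (factWord f)}

/-- `RFC_n(w, φ)`: the `φ`-flagged elements of `RF_n(w)`. -/
def RFCn (n : ℕ) (w : Equiv.Perm ℕ) (φ : ℕ → ℕ) : Set (ℕ → List ℕ) :=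
  {f | f ∈ RFn n w ∧ FlaggedFact φ f}

/-! ### Morse–Schilling crystal operators -/

/-- Pairing procedure: first argument is the block `r^{(i)}` in *decreasing* order, second is
the not-yet-paired part of the block `r^{(i+1)}` (in increasing order). Each letter `b` of
`r^{(i)}`, from largest to smallest, is paired with the smallest still unpaired letter of
`r^{(i+1)}` strictly larger than `b`. Returns the unpaired letters of `r^{(i+1)}`. -/
def unpairedUpper : List ℕ → List ℕ → List ℕ
  | [], A => A
  | b :: bs, A =>
    match A.find? (fun a => decide (b < a)) with
    | some a => unpairedUpper bs (A.erase a)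
    | none => unpairedUpper bs A

/-- As in `unpairedUpper`, but returns the unpaired letters of `r^{(i)}`. -/
def unpairedLower : List ℕ → List ℕ → List ℕ
  | [], _ => []
  | b :: bs, A =>
    match A.find? (fun a => decide (b < a)) with
    | some a => unpairedLower bs (A.erase a)
    | none => b :: unpairedLower bs A

/-- Insert a letter into a weakly increasing list, keeping it increasing. -/
def insAsc (x : ℕ) : List ℕ → List ℕ
  | [] => [x]
  | y :: ys => if x ≤ y then x :: y :: ys else y :: insAsc x ys

/-- The Morse–Schilling raising operator `e_i`: if every letter of block `i+1` is paired,
the result is `none` (i.e. `0`); otherwise the largest unpaired letter `a` of block `i+1` is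
removed and `a + s` is added to block `i`, where `s = min {j ≥ 0 | a+j+1 ∉ r^{(i+1)}}`. -/
def msE (i : ℕ) (f : ℕ → List ℕ) : Option (ℕ → List ℕ) :=
  let B := f i
  let A := f (i + 1)
  let L := unpairedUpper B.reverse A
  if L = [] then none
  else
    let a := L.foldr max 0
    let s := sInf {j : ℕ | (a + j + 1) ∉ A}
    some (Function.update (Function.update f (i + 1) (A.erase a)) i (insAsc (a + s) B))

/-- The Morse–Schilling lowering operator `f_i`: if every letter of block `i` is paired,
the result is `none`; otherwise the smallest unpaired letter `b` of block `i` is removed and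
`b - t` is added to block `i+1`, where `t = min {j ≥ 0 | b-j-1 ∉ r^{(i)}}`. -/
def msF (i : ℕ) (f : ℕ → List ℕ) : Option (ℕ → List ℕ) :=
  let B := f i
  let A := f (i + 1)
  let R := unpairedLower B.reverse A
  if R = [] then none
  else
    let b := R.foldr min R.headI
    let t := sInf {j : ℕ | (b - j - 1) ∉ B}
    some (Function.update (Function.update f i (B.erase b)) (i + 1) (insAsc (b - t) A))

/-- Iteration `e_j^k` of the raising operator. -/
def msEIter (j : ℕ) : ℕ → (ℕ → List ℕ) → Option (ℕ → List ℕ)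
  | 0, f => some f
  | k + 1, f => (msE j f).bind (msEIter j k)

/-- The Demazure operator `𝔇_j` on subsets of the crystal `RF_n(w)`:
`𝔇_j X = {b ∈ RF_n(w) | e_j^k(b) ∈ X for some k ≥ 0}`. -/
def demOp (n : ℕ) (w : Equiv.Perm ℕ) (j : ℕ) (X : Set (ℕ → List ℕ)) : Set (ℕ → List ℕ) :=
  {b | b ∈ RFn n w ∧ ∃ (k : ℕ) (c : ℕ → List ℕ), msEIter j k b = some c ∧ c ∈ X}

/-- `𝔇_{i_1} 𝔇_{i_2} ⋯ 𝔇_{i_k} X` for a word `i_1 i_2 ⋯ i_k` (the head is applied last). -/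
def demWord (n : ℕ) (w : Equiv.Perm ℕ) : List ℕ → Set (ℕ → List ℕ) → Set (ℕ → List ℕ)
  | [], X => X
  | j :: rest, X => demOp n w j (demWord n w rest X)

/-- `𝔇_{b↓a} = 𝔇_{b-1} 𝔇_{b-2} ⋯ 𝔇_a` (the identity when `b ≤ a`). -/
def demDown (n : ℕ) (w : Equiv.Perm ℕ) (b a : ℕ) (X : Set (ℕ → List ℕ)) :
    Set (ℕ → List ℕ) :=
  demWord n w ((List.range' a (b - a)).reverse) X

/-! ### Key tableaux -/

/-- A key tableau: a filling of a left-justified diagram in the positively indexed rows,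
with positive entries, weakly decreasing rows, distinct column entries, and the key
condition (c) of Assaf–Schilling. -/
def IsKeyTableau (T : Tableau) : Prop :=
  (∀ (r : ℤ) (c : ℕ), r ≤ 0 → T r c = 0) ∧
  (∀ r : ℤ, T r 0 = 0) ∧
  {p : ℤ × ℕ | T p.1 p.2 ≠ 0}.Finite ∧
  (∀ (r : ℤ) (c : ℕ), 1 ≤ c → T r (c + 1) ≠ 0 → T r c ≠ 0) ∧
  (∀ (r : ℤ) (c : ℕ), 1 ≤ c → T r (c + 1) ≠ 0 → T r (c + 1) ≤ T r c) ∧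
  (∀ (r r' : ℤ) (c : ℕ), r ≠ r' → T r c ≠ 0 → T r' c ≠ 0 → T r c ≠ T r' c) ∧
  (∀ (r r' : ℤ) (c : ℕ), r < r' → T r c ≠ 0 → T r' c ≠ 0 → T r' c < T r c →
      T r (c + 1) ≠ 0 ∧ T r' c < T r (c + 1))

/-- The tableau is `φ`-flagged: every entry in row `i` is at most `φ(i)`. -/
def FlaggedTab (φ : ℕ → ℕ) (T : Tableau) : Prop := ∀ (i c : ℕ), T (i : ℤ) c ≤ φ i

/-- `SSKT(α, φ)`: the `φ`-flagged key tableaux of shape `α`. -/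
def SSKT (α φ : ℕ → ℕ) : Set Tableau :=
  {T | IsKeyTableau T ∧ shapeOf T = α ∧ FlaggedTab φ T}

/-- The weight of a tableau: `wt(T)_v` is the number of entries equal to `v`. -/
def wtTab (T : Tableau) : ℕ → ℕ := fun v =>
  if v = 0 then 0 else Set.ncard {p : ℤ × ℕ | T p.1 p.2 = v}

/-- The weight of a word: the multiplicity of each positive letter. -/
def wtWord (u : List ℕ) : ℕ → ℕ := fun v => if v = 0 then 0 else u.count v

/-- The statistic `m_i(col(T), j)` where position `j` of the reverse column reading word
(entries read down columns, from right to left) is the box in row `r`, column `c`: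
the number of entries `i+1` weakly after this box minus the number of entries `i`. -/
def mi (T : Tableau) (i : ℕ) (r : ℤ) (c : ℕ) : ℤ :=
  (Set.ncard {p : ℤ × ℕ | T p.1 p.2 = i + 1 ∧ (p.2 < c ∨ (p.2 = c ∧ p.1 ≤ r))} : ℤ) -
  (Set.ncard {p : ℤ × ℕ | T p.1 p.2 = i ∧ (p.2 < c ∨ (p.2 = c ∧ p.1 ≤ r))} : ℤ)

/-- The box `(r, c)` maximizes `m_i` among all boxes of `T`. -/
def isMaxBox (T : Tableau) (i : ℕ) (r : ℤ) (c : ℕ) : Prop :=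
  T r c ≠ 0 ∧ ∀ (r' : ℤ) (c' : ℕ), T r' c' ≠ 0 → mi T i r' c' ≤ mi T i r c

/-- The Assaf–Schilling raising operator `e_i` on key tableaux.  If `m_i(col(T)) ≤ 0` the
result is `none` (i.e. `0`); otherwise, with `q` the largest position of the reverse column
reading word achieving the maximum (i.e. the maximizing box with the smallest column index,
and the smallest row index in that column), all entries `i+1` in the row of `q` weakly to its
right are changed to `i`, and all entries `i` in the same columns as these entries are
changed to `i+1`. -/
def keyE (i : ℕ) (T : Tableau) : Option Tableau :=
  if h : ∃ (r : ℤ) (c : ℕ), isMaxBox T i r c ∧ 1 ≤ mi T i r c then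
    let cq := sInf {c : ℕ | ∃ r : ℤ, isMaxBox T i r c}
    let rq : ℤ := ((sInf {m : ℕ | isMaxBox T i ((m : ℕ) : ℤ) cq} : ℕ) : ℤ)
    some (fun r c =>
      if cq ≤ c ∧ T rq c = i + 1 then
        (if T r c = i + 1 then i else if T r c = i then i + 1 else T r c)
      else T r c)
  else none

/-- The Assaf–Schilling lowering operator `f_i`: the (unique) inverse of `e_i`. -/
def keyF (i : ℕ) (T : Tableau) : Option Tableau :=
  if h : ∃ T', keyE i T' = some T then some h.choose else none

/-- Restriction of a partially defined crystal operator to a subset: the operator returns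
`none` (i.e. `0`) whenever it would leave the subset. -/
def restrictOp {β : Type} (S : Set β) (op : β → Option β) (x : β) : Option β :=
  (op x).bind fun y => if y ∈ S then some y else none

/-! ### Polynomials: divided differences and key polynomials -/

/-- The divided difference operator `∂_i f = (f - s_i · f) / (x_i - x_{i+1})`. -/
def divDiff (i : ℕ) (fp : MvPolynomial ℕ ℤ) : MvPolynomial ℕ ℤ :=
  if h : ∃ g : MvPolynomial ℕ ℤ,
      g * (MvPolynomial.X i - MvPolynomial.X (i + 1)) =
        fp - MvPolynomial.rename (fun j => sPerm i j) fp
  then h.choose else 0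

/-- The isobaric divided difference operator `π_i f = ∂_i (x_i f)`. -/
def piOp (i : ℕ) (fp : MvPolynomial ℕ ℤ) : MvPolynomial ℕ ℤ :=
  divDiff i (MvPolynomial.X i * fp)

/-- `π_{i_1} π_{i_2} ⋯ π_{i_k} f` for a word `i_1 i_2 ⋯ i_k` (the head is applied last). -/
def piWord : List ℕ → MvPolynomial ℕ ℤ → MvPolynomial ℕ ℤ
  | [], fp => fp
  | i :: rest, fp => piOp i (piWord rest fp)

/-- `π_{b↓a} = π_{b-1} π_{b-2} ⋯ π_a` (the identity when `b ≤ a`). -/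
def piDown (b a : ℕ) (fp : MvPolynomial ℕ ℤ) : MvPolynomial ℕ ℤ :=
  piWord ((List.range' a (b - a)).reverse) fp

/-- The conjugate of a weak composition: `conjC α t = #{j ≥ 1 | α_j ≥ t}` for `t ≥ 1`. -/
def conjC (α : ℕ → ℕ) (t : ℕ) : ℕ :=
  Set.ncard {j : ℕ | 1 ≤ j ∧ 1 ≤ t ∧ t ≤ α j}

/-- The partition rearrangement of a weak composition (the conjugate of its conjugate). -/
def sortC (α : ℕ → ℕ) : ℕ → ℕ := conjC (conjC α)

/-- The length of a permutation: the common length of its reduced words. -/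
def permLength (w : Equiv.Perm ℕ) : ℕ :=
  sInf {n : ℕ | ∃ ρ : List ℕ, PosWord ρ ∧ wordPerm ρ = w ∧ ρ.length = n}

/-- The monomial `x^β = x_1^{β_1} x_2^{β_2} ⋯`. -/
def xExp (β : ℕ → ℕ) : MvPolynomial ℕ ℤ :=
  ∏ i ∈ Finset.range (sSup {n : ℕ | β n ≠ 0} + 1), MvPolynomial.X i ^ β i

/-- The key polynomial `κ_α = π_w x^λ` where `λ` is the partition rearrangement of `α` and
`w` is the minimal-length permutation of `S∞` with `α · w = λ`. -/
def keyPoly (α : ℕ → ℕ) : MvPolynomial ℕ ℤ :=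
  if h : ∃ (ρ : List ℕ) (w : Equiv.Perm ℕ), IsReducedWordFor w ρ ∧
      (∀ i, α (w i) = sortC α i) ∧
      (∀ v : Equiv.Perm ℕ, (∃ τ, IsReducedWordFor v τ) → (∀ i, α (v i) = sortC α i) →
        permLength w ≤ permLength v)
  then piWord h.choose (xExp (sortC α)) else 0

/-- The `φ`-flagged key polynomial `κ_{(α,φ)} = Σ_{T ∈ SSKT(α,φ)} x^{wt(T)}`. -/
def flaggedKeyPoly (α φ : ℕ → ℕ) : MvPolynomial ℕ ℤ :=
  ∑ᶠ T ∈ SSKT α φ, xExp (wtTab T)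

/-! ### Column insertion, keys, standardization -/

/-- The number of boxes in column `c` of a tableau. -/
def colHeightN (T : Tableau) (c : ℕ) : ℕ := Set.ncard {r : ℤ | T r c ≠ 0}

/-- One pass of column insertion: insert the value `x` starting at column `c`
(`fuel` bounds the number of columns visited). -/
def colInsertAux : ℕ → Tableau → ℕ → ℕ → Tableau
  | 0, T, _, _ => T
  | fuel + 1, T, c, x =>
    if ∀ r : ℤ, T r c ≠ 0 → T r c < x then
      -- x is greater than every entry of column c: place it at the end of the column
      fun r c' => if c' = c ∧ r = (colHeightN T c + 1 : ℤ) then x else T r c'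
    else if ∃ r : ℤ, T r c = x then
      -- column c contains x: move on to the next column with the same value
      colInsertAux fuel T (c + 1) x
    else
      -- bump the smallest entry of column c that is larger than x
      let y := sInf {v : ℕ | x < v ∧ ∃ r : ℤ, T r c = v}
      colInsertAux fuel (fun r c' => if c' = c ∧ T r c' = y then x else T r c') (c + 1) y

/-- Column insertion of `x` into the semistandard Young tableau `T`. -/
def colInsert (T : Tableau) (x : ℕ) : Tableau :=
  colInsertAux (sSup {c : ℕ | ∃ r : ℤ, T r c ≠ 0} + 2) T 1 x

/-- The insertion tableau `P` of `(v → ∅)`: successively column insert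
`v_n, v_{n-1}, …, v_1` into the empty tableau. -/
def insertP (v : List ℕ) : Tableau :=
  v.reverse.foldl colInsert (fun _ _ => 0)

/-- The recording tableau `Q` of `(v → ∅)`: the standard Young tableau whose restriction to
`{1, …, j}` has the same shape as the insertion tableau of the last `j` letters of `v`. -/
def insertQ (v : List ℕ) : Tableau := fun r c =>
  sInf {j : ℕ | insertP (v.drop (v.length - j)) r c ≠ 0}

/-- The key `key(α)`: the unique semistandard Young tableau of weight `α` such that the set
of entries of column `i+1` is a subset of the entries of column `i`; its column `c` consists
of the elements of `{x ≥ 1 | α_x ≥ c}` in increasing order from bottom to top. -/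
def keyTab (α : ℕ → ℕ) : Tableau := fun r c =>
  if c = 0 then 0
  else sInf {x : ℕ | 1 ≤ x ∧ c ≤ α x ∧
    ((Set.ncard {y : ℕ | 1 ≤ y ∧ c ≤ α y ∧ y ≤ x} : ℕ) : ℤ) = r}

/-- The standardization of a semistandard Young tableau: the `1`'s are replaced from left to
right by `1, …, β_1`, the `2`'s by `β_1 + 1, …, β_1 + β_2`, and so on. -/
def stdTab (T : Tableau) : Tableau := fun r c =>
  if T r c = 0 then 0
  else Set.ncard {p : ℤ × ℕ |
    T p.1 p.2 ≠ 0 ∧ (T p.1 p.2 < T r c ∨ (T p.1 p.2 = T r c ∧ p.2 ≤ c))}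

/-! ### Maximal factorizations (Reiner–Shimozono) -/

/-- Every block is weakly increasing. -/
def WeaklyIncrFact (g : ℕ → List ℕ) : Prop := ∀ i, List.Chain' (· ≤ ·) (g i)

/-- Maximality: the nonempty blocks have maximal length, i.e. there is a strict descent
between any two consecutive nonempty blocks (no letter can be moved from the end of a block
to the front of the next one to the right). -/
def MaxFact (g : ℕ → List ℕ) : Prop :=
  ∀ i j : ℕ, 1 ≤ i → i < j → g i ≠ [] → g j ≠ [] → (∀ m, i < m → m < j → g m = []) →
    (g i).headI < (g j).getLastD 0

/-- Reiner–Shimozono's set `𝒲(α, φ)` of `φ`-flagged maximal factorizations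
`u^• = u^n ⋯ u^2 u^1` with `ℓ(u^i) = α_i` and `(u → ∅) = (P, std(key(α)))`. -/
def Wset (α φ : ℕ → ℕ) : Set (ℕ → List ℕ) :=
  {g | g 0 = [] ∧ (∀ i, (g i).length = α i) ∧ (∀ i, ∀ x ∈ g i, 1 ≤ x) ∧
       WeaklyIncrFact g ∧ MaxFact g ∧ (∀ i, ∀ x ∈ g i, x ≤ φ i) ∧
       insertQ (factWord g) = stdTab (keyTab α)}

/-! ### Shifts and highest weight key tableaux -/

/-- `shift_N`: add `N` to every letter of every block. -/
def shiftFact (N : ℕ) (f : ℕ → List ℕ) : ℕ → List ℕ := fun i => (f i).map (· + N)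

/-- The tableau of shape `α` whose column `i` is filled by `1, 2, …, λ^T_i` in increasing
order from bottom to top (where `λ^T` is the conjugate of the partition rearrangement `λ`
of `α`): the box of column `c` in row `m` (where `α_m ≥ c`) contains the number of indices
`m' ≤ m` with `α_{m'} ≥ c`. -/
def highKeyTab (α : ℕ → ℕ) : Tableau := fun r c =>
  if c = 0 then 0
  else if ∃ m : ℕ, (m : ℤ) = r ∧ 1 ≤ m ∧ c ≤ α m then
    Set.ncard {m : ℕ | 1 ≤ m ∧ c ≤ α m ∧ (m : ℤ) ≤ r}
  else 0


/-- A `gl_n`-crystal isomorphism between two sets of key tableaux, both equipped with the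
Assaf–Schilling operators (restricted to the sets): a weight-preserving bijection commuting
with all raising and lowering operators `e_i, f_i` for `1 ≤ i < n`. -/
def SSKTIso (n : ℕ) (S₁ S₂ : Set Tableau) : Prop :=
  ∃ g : Tableau → Tableau, Set.BijOn g S₁ S₂ ∧
    (∀ T ∈ S₁, wtTab T = wtTab (g T)) ∧
    ∀ T ∈ S₁, ∀ i : ℕ, 1 ≤ i → i < n →
      Option.map g (restrictOp S₁ (keyE i) T) = restrictOp S₂ (keyE i) (g T) ∧
      Option.map g (restrictOp S₁ (keyF i) T) = restrictOp S₂ (keyF i) (g T)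

end
/-! ### Coxeter–Knuth equivalence of integer words -/

/-- The elementary Coxeter–Knuth moves on three consecutive letters of an integer word. -/
inductive CKLocal : List ℤ → List ℤ → Prop
  | right {x y z : ℤ} : y < x → x < z → CKLocal [x, y, z] [x, z, y]
  | left {x y z : ℤ} : y < z → z < x → CKLocal [x, y, z] [y, x, z]
  | braid (i : ℤ) : CKLocal [i, i + 1, i] [i + 1, i, i + 1]

/-- Coxeter–Knuth equivalence of integer words. -/
inductive CKZ : List ℤ → List ℤ → Prop
  | refl (u : List ℤ) : CKZ u u
  | symm {u v : List ℤ} : CKZ u v → CKZ v u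
  | trans {u v w : List ℤ} : CKZ u v → CKZ v w → CKZ u w
  | step (a b : List ℤ) {s t : List ℤ} : CKLocal s t → CKZ (a ++ s ++ b) (a ++ t ++ b)

namespace CKZ

theorem append_left (a : List ℤ) {u v : List ℤ} (h : CKZ u v) : CKZ (a ++ u) (a ++ v) := by
  induction h with
  | refl u => exact .refl _
  | symm _ ih => exact ih.symm
  | trans _ _ ih₁ ih₂ => exact ih₁.trans ih₂
  | step c b h => simpa using CKZ.step (a ++ c) b h

theorem append_right {u v : List ℤ} (h : CKZ u v) (b : List ℤ) : CKZ (u ++ b) (v ++ b) := by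
  induction h with
  | refl u => exact .refl _
  | symm _ ih => exact ih.symm
  | trans _ _ ih₁ ih₂ => exact ih₁.trans ih₂
  | step c d h => simpa using CKZ.step c (d ++ b) h

theorem cons (z : ℤ) {u v : List ℤ} (h : CKZ u v) : CKZ (z :: u) (z :: v) :=
  h.append_left [z]

theorem of_local {s t : List ℤ} (h : CKLocal s t) : CKZ s t := by
  simpa using CKZ.step [] [] h

theorem reverse {u v : List ℤ} (h : CKZ u v) : CKZ u.reverse v.reverse := by
  induction h with
  | refl u => exact .refl _
  | symm _ ih => exact ih.symm
  | trans _ _ ih₁ ih₂ => exact ih₁.trans ih₂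
  | step a b h =>
    simp only [List.reverse_append]
    refine (append_right ?_ _).append_left _
    cases h with
    | right h₁ h₂ => exact of_local (.left h₁ h₂)
    | left h₁ h₂ => exact of_local (.right h₁ h₂)
    | braid i => exact of_local (.braid i)

theorem map_neg {u v : List ℤ} (h : CKZ u v) : CKZ (u.map (- ·)) (v.map (- ·)) := by
  induction h with
  | refl u => exact .refl _
  | symm _ ih => exact ih.symm
  | trans _ _ ih₁ ih₂ => exact ih₁.trans ih₂
  | step a b h =>
    simp only [List.map_append]
    refine append_right (append_left _ ?_) _
    cases h with
    | right h₁ h₂ => exact (of_local (.right (neg_lt_neg h₂) (neg_lt_neg h₁))).symm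
    | left h₁ h₂ => exact (of_local (.left (neg_lt_neg h₂) (neg_lt_neg h₁))).symm
    | braid i =>
      obtain ⟨j, rfl⟩ : ∃ j, i = -(j + 1) := ⟨-i - 1, by ring⟩
      have h₁ : -(-(j + 1)) = j + 1 := by ring
      have h₂ : -(-(j + 1) + 1) = j := by ring
      simp only [List.map, h₁, h₂]
      exact (of_local (.braid j)).symm

theorem length_eq {u v : List ℤ} (h : CKZ u v) : u.length = v.length := by
  induction h with
  | refl u => rfl
  | symm _ ih => exact ih.symm
  | trans _ _ ih₁ ih₂ => exact ih₁.trans ih₂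
  | step a b h => cases h <;> simp

theorem mem_iff {u v : List ℤ} (h : CKZ u v) (x : ℤ) : x ∈ u ↔ x ∈ v := by
  induction h with
  | refl u => rfl
  | symm _ ih => exact ih.symm
  | trans _ _ ih₁ ih₂ => exact ih₁.trans ih₂
  | step a b h => cases h <;> simp <;> tauto

end CKZ

/-! ### Words without removable pairs of equal letters -/

/-- No word in the Coxeter–Knuth class contains two equal letters separated only by letters
that are not adjacent or equal to them.  Reduced words have this property. -/
def Good (σ : List ℤ) : Prop :=
  ∀ τ, CKZ σ τ → ∀ (a b u : List ℤ) (z : ℤ), τ = a ++ z :: u ++ z :: b →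
    ∃ c ∈ u, z - 1 ≤ c ∧ c ≤ z + 1

namespace Good

theorem congr {σ τ : List ℤ} (hσ : Good σ) (h : CKZ σ τ) : Good τ :=
  fun _ h' => hσ _ (h.trans h')

theorem factor {a σ b : List ℤ} (h : Good (a ++ σ ++ b)) : Good σ := by
  rintro τ hτ c d u z rfl
  exact h _ ((hτ.append_left a).append_right b) (a ++ c) (d ++ b) u z (by simp)

theorem left {σ b : List ℤ} (h : Good (σ ++ b)) : Good σ :=
  factor (a := []) (b := b) (by simpa using h)

theorem right {a σ : List ℤ} (h : Good (a ++ σ)) : Good σ :=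
  factor (a := a) (b := []) (by simpa using h)

theorem reverse {σ : List ℤ} (h : Good σ) : Good σ.reverse := by
  rintro τ hτ a b u z rfl
  obtain ⟨c, hc, h'⟩ := h _ (by simpa using hτ.reverse) b.reverse a.reverse u.reverse z (by simp)
  exact ⟨c, by simpa using hc, h'⟩

theorem map_neg {σ : List ℤ} (h : Good σ) : Good (σ.map (- ·)) := by
  rintro τ hτ a b u z rfl
  obtain ⟨c, hc, h'⟩ := h _ (by simpa using hτ.map_neg) (a.map (- ·)) (b.map (- ·))
    (u.map (- ·)) (-z) (by simp)
  refine ⟨-c, ?_, by omega, by omega⟩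
  obtain ⟨d, hd, rfl⟩ := List.mem_map.1 hc
  simpa using hd

end Good

/-! ### Edelman–Greene insertion into one row -/

/-- The elements of a finite set of integers in increasing order. -/
def word (r : Finset ℤ) : List ℤ := r.sort (· ≤ ·)

theorem mem_word {r : Finset ℤ} {x : ℤ} : x ∈ word r ↔ x ∈ r := by simp [word]

theorem length_word (r : Finset ℤ) : (word r).length = r.card := by simp [word]

theorem pairwise_word (r : Finset ℤ) : (word r).Pairwise (· < ·) :=
  r.sortedLT_sort.pairwise

theorem word_eq {r : Finset ℤ} {l : List ℤ} (hl : l.Pairwise (· < ·))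
    (h : ∀ x, x ∈ l ↔ x ∈ r) : word r = l := by
  refine List.Perm.eq_of_pairwise (le := (· < ·)) (fun a b _ _ h₁ h₂ => absurd h₁ h₂.asymm)
    (pairwise_word r) hl ?_
  refine (List.perm_ext_iff_of_nodup (pairwise_word r).nodup hl.nodup).2 fun x => ?_
  rw [mem_word, h]

theorem word_empty : word ∅ = [] := by simp [word]

/-- Edelman–Greene insertion of a letter into a row: the new row, and the bumped letter. -/
def rowIns (r : Finset ℤ) (z : ℤ) : Finset ℤ × List ℤ :=
  if h : (r.filter (z < ·)).Nonempty then
    (if z ∈ r then r else insert z (r.erase ((r.filter (z < ·)).min' h)),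
      [(r.filter (z < ·)).min' h])
  else (insert z r, [])

theorem rowIns_none {r : Finset ℤ} {z : ℤ} (h : ∀ a ∈ r, a ≤ z) :
    rowIns r z = (insert z r, []) := by
  rw [rowIns, dif_neg]
  rintro ⟨a, ha⟩
  have := Finset.mem_filter.1 ha
  have := h a this.1
  omega

theorem rowIns_some {r : Finset ℤ} {z b : ℤ} (hb : b ∈ r) (hz : z < b)
    (h : ∀ a ∈ r, z < a → b ≤ a) :
    rowIns r z = (if z ∈ r then r else insert z (r.erase b), [b]) := by
  have hne : (r.filter (z < ·)).Nonempty := ⟨b, by simp [hb, hz]⟩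
  have : (r.filter (z < ·)).min' hne = b := by
    refine le_antisymm (Finset.min'_le _ _ (by simp [hb, hz])) (Finset.le_min' _ _ _ ?_)
    intro a ha
    have := Finset.mem_filter.1 ha
    exact h a this.1 this.2
  rw [rowIns, dif_pos hne, this]

theorem exists_next (r : Finset ℤ) (z : ℤ) :
    (∀ a ∈ r, a ≤ z) ∨ ∃ b ∈ r, z < b ∧ ∀ a ∈ r, z < a → b ≤ a := by
  by_cases hne : (r.filter (z < ·)).Nonempty
  · right
    have hm := Finset.min'_mem _ hne
    refine ⟨_, (Finset.mem_filter.1 hm).1, (Finset.mem_filter.1 hm).2, fun a ha hz => ?_⟩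
    exact Finset.min'_le _ _ (by simp [ha, hz])
  · left
    intro a ha
    by_contra! hc
    exact hne ⟨a, by simp [ha, hc]⟩

theorem Good.add_one_mem {r : Finset ℤ} {z : ℤ} (h : Good (word r ++ [z])) (hz : z ∈ r) :
    z + 1 ∈ r := by
  have hw : word r = word (r.filter (· < z)) ++ z :: word (r.filter (z < ·)) := by
    apply word_eq
    · simp only [List.pairwise_append, List.pairwise_cons, pairwise_word, mem_word,
        Finset.mem_filter, List.mem_cons, true_and, and_true]
      grind
    · simp only [List.mem_append, List.mem_cons, mem_word, Finset.mem_filter]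
      grind
  obtain ⟨c, hc, h₁, h₂⟩ := h _ (.refl _) (word (r.filter (· < z))) [] (word (r.filter (z < ·))) z
    (by rw [hw])
  rw [mem_word, Finset.mem_filter] at hc
  obtain rfl : c = z + 1 := by omega
  exact hc.1

theorem ckz_slide_small {z : ℤ} : ∀ {b : ℤ} {H : List ℤ}, z < b → (b :: H).Pairwise (· < ·) →
    CKZ (b :: H ++ [z]) (b :: z :: H)
  | b, [], _, _ => .refl _
  | b, h :: H, hz, hp => by
    have hbh : b < h := by simp at hp; exact hp.1.1
    refine ((ckz_slide_small (hz.trans hbh) hp.of_cons).cons b).trans ?_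
    exact ((CKZ.of_local (.right hz hbh)).symm.append_right H)

theorem ckz_slide_large {b z : ℤ} (hb : z < b) : ∀ {L : List ℤ}, (L ++ [z]).Pairwise (· < ·) →
    CKZ (L ++ [b, z]) (b :: L ++ [z])
  | [], _ => .refl _
  | l :: L, hp => by
    refine ((ckz_slide_large hb (L := L) hp.of_cons).cons l).trans ?_
    have hl : ∀ x ∈ L ++ [z], l < x := (List.pairwise_cons.1 hp).1
    have hlt : ∀ x ∈ L ++ [z], x < b := by
      have := (List.pairwise_append.1 hp.of_cons).2.2
      intro x hx
      rcases List.mem_append.1 hx with h | h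
      · exact (this x h z (by simp)).trans hb
      · simp at h; omega
    rcases L with _ | ⟨l', L⟩
    · exact (CKZ.of_local (.left (hl z (by simp)) (hlt z (by simp)))).symm
    · exact (CKZ.of_local (.left (hl l' (by simp)) (hlt l' (by simp)))).symm.append_right (L ++ [z])

theorem ckz_rowIns {r : Finset ℤ} {z : ℤ} (h : Good (word r ++ [z])) :
    CKZ (word r ++ [z]) ((rowIns r z).2 ++ word (rowIns r z).1) := by
  rcases exists_next r z with hz | ⟨b, hb, hzb, hmin⟩
  · have hzr : z ∉ r := fun hzr => by
      have := hz _ (h.add_one_mem hzr)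
      omega
    have hr : word (insert z r) = word r ++ [z] := by
      apply word_eq
      · simp only [List.pairwise_append, pairwise_word, mem_word]
        grind
      · grind [mem_word]
    rw [rowIns_none hz, hr]
    exact .refl _
  · rw [rowIns_some hb hzb hmin]
    set H := word (r.filter (b < ·)) with hH
    set L := word (r.filter (· < z)) with hL
    have hbH : (b :: H).Pairwise (· < ·) := by
      simp only [List.pairwise_cons, hH, pairwise_word, mem_word]
      grind
    have hLz : (L ++ [z]).Pairwise (· < ·) := by
      simp only [List.pairwise_append, hL, pairwise_word, mem_word]
      grind
    by_cases hzr : z ∈ r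
    · have hb1 : b = z + 1 := by
        have := hmin _ (h.add_one_mem hzr) (by omega)
        omega
      have hr : word r = L ++ z :: b :: H := by
        apply word_eq
        · simp only [List.pairwise_append, List.pairwise_cons, hH, hL, pairwise_word, mem_word,
            List.mem_cons, Finset.mem_filter, true_and, and_true]
          grind
        · simp only [List.mem_append, List.mem_cons, mem_word, Finset.mem_filter, hH, hL]
          grind
      rw [if_pos hzr, hr]
      subst hb1
      have h₁ := (ckz_slide_small hzb hbH).append_left (L ++ [z])
      have h₂ := ((CKZ.of_local (.braid z)).append_right H).append_left L
      have h₃ := (ckz_slide_large hzb hLz).append_right ((z + 1) :: H)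
      simp only [List.append_assoc, List.cons_append, List.nil_append] at h₁ h₂ h₃ ⊢
      exact (h₁.trans h₂).trans h₃
    · have hr : word r = L ++ b :: H := by
        apply word_eq
        · simp only [List.pairwise_append, List.pairwise_cons, hH, hL, pairwise_word, mem_word,
            List.mem_cons, Finset.mem_filter, true_and, and_true]
          grind
        · simp only [List.mem_append, List.mem_cons, mem_word, Finset.mem_filter, hH, hL]
          grind
      have hr' : word (insert z (r.erase b)) = L ++ z :: H := by
        apply word_eq
        · simp only [List.pairwise_append, List.pairwise_cons, hH, hL, pairwise_word, mem_word,
            List.mem_cons, Finset.mem_filter, true_and, and_true]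
          grind
        · simp only [List.mem_append, List.mem_cons, mem_word, Finset.mem_filter, hH, hL]
          grind
      rw [if_neg hzr, hr, hr']
      have h₁ := (ckz_slide_small hzb hbH).append_left L
      have h₃ := (ckz_slide_large hzb hLz).append_right H
      simp only [List.append_assoc, List.cons_append, List.nil_append] at h₁ h₃ ⊢
      exact h₁.trans h₃

theorem rowIns_bump {r : Finset ℤ} {z b : ℤ} (hb : b ∈ r) (hz : z < b)
    (h : ∀ a ∈ r, z < a → b ≤ a) (hzr : z ∉ r) :
    rowIns r z = (insert z (r.erase b), [b]) := by
  rw [rowIns_some hb hz h, if_neg hzr]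

theorem rowIns_keep {r : Finset ℤ} {z b : ℤ} (hb : b ∈ r) (hz : z < b)
    (h : ∀ a ∈ r, z < a → b ≤ a) (hzr : z ∈ r) : rowIns r z = (r, [b]) := by
  rw [rowIns_some hb hz h, if_pos hzr]

theorem mem_rowIns_self (r : Finset ℤ) (z : ℤ) : z ∈ (rowIns r z).1 := by
  rcases exists_next r z with h | ⟨b, hb, hz, hmin⟩
  · simp [rowIns_none h]
  · rw [rowIns_some hb hz hmin]
    split_ifs <;> simp [*]

/-- Successive insertion of the letters of a word into a row: the final row, and the word of
bumped letters. -/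
def rowRun (r : Finset ℤ) : List ℤ → Finset ℤ × List ℤ
  | [] => (r, [])
  | z :: w => ((rowRun (rowIns r z).1 w).1, (rowIns r z).2 ++ (rowRun (rowIns r z).1 w).2)

theorem rowRun_append (r : Finset ℤ) (u v : List ℤ) :
    rowRun r (u ++ v) = ((rowRun (rowRun r u).1 v).1, (rowRun r u).2 ++ (rowRun (rowRun r u).1 v).2) := by
  induction u generalizing r with
  | nil => rfl
  | cons z u ih => simp [rowRun, ih]

theorem ckz_rowRun {r : Finset ℤ} {w : List ℤ} (h : Good (word r ++ w)) :
    CKZ (word r ++ w) ((rowRun r w).2 ++ word (rowRun r w).1) := by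
  induction w generalizing r with
  | nil => simpa [rowRun] using CKZ.refl _
  | cons z w ih =>
    have h₁ := (ckz_rowIns (Good.left (b := w) (by simpa using h))).append_right w
    have h₂ : Good (word (rowIns r z).1 ++ w) := by
      refine Good.right (a := (rowIns r z).2) (h.congr ?_)
      simpa using h₁
    simpa [rowRun] using h₁.trans (by simpa using (ih h₂).append_left (rowIns r z).2)

theorem Good.rowRun {r : Finset ℤ} {u v : List ℤ} (h : Good (word r ++ (u ++ v))) :
    Good (word (rowRun r u).1 ++ v) := by
  rw [← List.append_assoc] at h
  have := h.congr ((ckz_rowRun h.left).append_right v)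
  rw [List.append_assoc] at this
  exact this.right

theorem rowIns_comm {r : Finset ℤ} {y z b : ℤ} (hb : b ∈ r) (hyb : y < b) (hbz : b < z)
    (hmin : ∀ a ∈ r, y < a → b ≤ a) :
    (rowIns (rowIns r y).1 z).1 = (rowIns (rowIns r z).1 y).1 ∧ (rowIns r y).2 = [b] ∧
    (rowIns (rowIns r z).1 y).2 = [b] ∧ (rowIns (rowIns r y).1 z).2 = (rowIns r z).2 := by
  rw [rowIns_some hb hyb hmin]
  rcases exists_next r z with h | ⟨c, hc, hzc, hcmin⟩
  · rw [rowIns_none h, rowIns_none (z := z), rowIns_some (z := y) (b := b)]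
    · refine ⟨?_, rfl, rfl, rfl⟩
      ext a
      grind
    · grind
    · grind
    · grind
    · grind
  · rw [rowIns_some hc hzc hcmin, rowIns_some (z := z) (b := c), rowIns_some (z := y) (b := b)]
    · refine ⟨?_, rfl, rfl, rfl⟩
      ext a
      grind
    all_goals grind

theorem rowRun_right {r : Finset ℤ} {x y z : ℤ} (hyx : y < x) (hxz : x < z)
    (hg : Good (word r ++ [x, y, z])) :
    (rowRun r [x, y, z]).1 = (rowRun r [x, z, y]).1 ∧
      CKZ (rowRun r [x, y, z]).2 (rowRun r [x, z, y]).2 := by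
  have hx : x ∈ r → x + 1 ∈ r :=
    (Good.left (σ := word r ++ [x]) (b := [y, z]) (by simpa using hg)).add_one_mem
  set s := (rowIns r x).1 with hs
  have hxs : x ∈ s := mem_rowIns_self r x
  obtain ⟨b, hb, hyb, hbmin⟩ := (exists_next s y).resolve_left (fun h => by grind)
  have hbx : b ≤ x := hbmin x hxs hyx
  obtain ⟨h₁, h₂, h₃, h₄⟩ := rowIns_comm hb hyb (hbx.trans_lt hxz) hbmin
  simp only [rowRun, ← hs, h₁, h₂, h₃, h₄, true_and]
  rcases exists_next s z with h | ⟨c, hc, hzc, hcmin⟩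
  · simpa [rowIns_none h] using CKZ.refl _
  · rcases exists_next r x with h' | ⟨d, hd, hxd, hdmin⟩
    · rw [rowIns_none h'] at hs
      grind
    · rw [rowIns_some hd hxd hdmin] at hs ⊢
      rw [rowIns_some hc hzc hcmin]
      refine CKZ.of_local (.right (hbx.trans_lt hxd) ?_)
      grind

theorem rowRun_left {r : Finset ℤ} {x y z : ℤ} (hyz : y < z) (hzx : z < x)
    (hg : Good (word r ++ [x, y, z])) :
    (rowRun r [x, y, z]).1 = (rowRun r [y, x, z]).1 ∧
      CKZ (rowRun r [x, y, z]).2 (rowRun r [y, x, z]).2 := by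
  have hx : x ∈ r → x + 1 ∈ r :=
    (Good.left (σ := word r ++ [x]) (b := [y, z]) (by simpa using hg)).add_one_mem
  have hy : y ∈ r → y + 1 ∈ r := by
    have hg' := hg.congr ((CKZ.of_local (.left hyz hzx)).append_left (word r))
    exact (Good.left (σ := word r ++ [y]) (b := [x, z]) (by simpa using hg')).add_one_mem
  rcases exists_next r y with h | ⟨b, hb, hyb, hbmin⟩
  · have e₁ : rowIns r x = (insert x r, []) := rowIns_none (by grind)
    have e₂ : rowIns (insert x r) y = (insert y ((insert x r).erase x), [x]) :=
      rowIns_bump (by grind) (by grind) (by grind) (by grind)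
    have e₃ : rowIns (insert y ((insert x r).erase x)) z =
      (insert z (insert y ((insert x r).erase x)), []) := rowIns_none (by grind)
    have f₁ : rowIns r y = (insert y r, []) := rowIns_none h
    have f₂ : rowIns (insert y r) x = (insert x (insert y r), []) := rowIns_none (by grind)
    have f₃ : rowIns (insert x (insert y r)) z = (insert z ((insert x (insert y r)).erase x), [x]) :=
      rowIns_bump (by grind) (by grind) (by grind) (by grind)
    simp only [rowRun, e₁, e₂, e₃, f₁, f₂, f₃]
    exact ⟨by ext a; grind, .refl _⟩
  rcases lt_trichotomy b x with hbx | rfl | hxb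
  · obtain ⟨h₁, h₂, h₃, h₄⟩ := rowIns_comm hb hyb hbx hbmin
    simp only [rowRun, h₁, h₂, h₃, h₄, true_and]
    set s := (rowIns (rowIns r x).1 y).1 with hs
    have hxs : x ∈ s := by rw [← h₁]; exact mem_rowIns_self _ x
    obtain ⟨e, he, hze, hemin⟩ := (exists_next s z).resolve_left (fun h => by grind)
    have hex : e ≤ x := hemin x hxs hzx
    have hbe : b < e := by
      rw [rowIns_some hb hyb hbmin] at h₁
      rw [← h₁] at he
      rcases exists_next r x with h' | ⟨d, hd, hxd, hdmin⟩
      · rw [rowIns_none (z := x) (by grind)] at he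
        grind
      · rw [rowIns_some (z := x) (b := d) (by grind) (by grind) (by grind)] at he
        grind
    rw [rowIns_some he hze hemin]
    rcases exists_next r x with h' | ⟨d, hd, hxd, hdmin⟩
    · simpa [rowIns_none h'] using CKZ.refl _
    · rw [rowIns_some hd hxd hdmin]
      exact CKZ.of_local (.left hbe (hex.trans_lt hxd))
  · have e₁ : rowIns r b = (r, [b + 1]) := rowIns_keep (hx hb) (by grind) (by grind) hb
    have e₂ : rowIns r y = (insert y (r.erase b), [b]) := rowIns_bump hb hyb hbmin (by grind)
    have e₃ : rowIns (insert y (r.erase b)) z =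
        (insert z ((insert y (r.erase b)).erase (b + 1)), [b + 1]) :=
      rowIns_bump (by grind) (by grind) (by grind) (by grind)
    have f₂ : rowIns (insert y (r.erase b)) b =
        (insert b ((insert y (r.erase b)).erase (b + 1)), [b + 1]) :=
      rowIns_bump (by grind) (by grind) (by grind) (by grind)
    have f₃ : rowIns (insert b ((insert y (r.erase b)).erase (b + 1))) z =
        (insert z ((insert b ((insert y (r.erase b)).erase (b + 1))).erase b), [b]) :=
      rowIns_bump (by grind) (by grind) (by grind) (by grind)
    simp only [rowRun, e₁, e₂, e₃, f₂, f₃]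
    exact ⟨by ext a; grind, (CKZ.of_local (.braid b)).symm⟩
  · have e₁ : rowIns r x = (insert x (r.erase b), [b]) :=
      rowIns_bump hb hxb (by grind) (by grind)
    have e₂ : rowIns (insert x (r.erase b)) y = (insert y ((insert x (r.erase b)).erase x), [x]) :=
      rowIns_bump (by grind) (by grind) (by grind) (by grind)
    have e₂' : insert y ((insert x (r.erase b)).erase x) = insert y (r.erase b) := by
      ext a; grind
    have f₁ : rowIns r y = (insert y (r.erase b), [b]) := rowIns_bump hb hyb hbmin (by grind)
    rw [e₂'] at e₂
    rcases exists_next (insert y (r.erase b)) z with h | ⟨c, hc, hzc, hcmin⟩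
    · have e₃ := rowIns_none h
      have f₂ : rowIns (insert y (r.erase b)) x = (insert x (insert y (r.erase b)), []) :=
        rowIns_none (by grind)
      have f₃ : rowIns (insert x (insert y (r.erase b))) z =
          (insert z ((insert x (insert y (r.erase b))).erase x), [x]) :=
        rowIns_bump (by grind) (by grind) (by grind) (by grind)
      simp only [rowRun, e₁, e₂, e₃, f₁, f₂, f₃]
      exact ⟨by ext a; grind, .refl _⟩
    · have e₃ := rowIns_bump hc hzc hcmin (by grind)
      have f₂ : rowIns (insert y (r.erase b)) x =
          (insert x ((insert y (r.erase b)).erase c), [c]) :=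
        rowIns_bump (by grind) (by grind) (by grind) (by grind)
      have f₃ : rowIns (insert x ((insert y (r.erase b)).erase c)) z =
          (insert z ((insert x ((insert y (r.erase b)).erase c)).erase x), [x]) :=
        rowIns_bump (by grind) (by grind) (by grind) (by grind)
      simp only [rowRun, e₁, e₂, e₃, f₁, f₂, f₃]
      exact ⟨by ext a; grind, CKZ.of_local (.right (by grind) (by grind))⟩

theorem rowRun_braid {r : Finset ℤ} {i : ℤ} (hg : Good (word r ++ [i, i + 1, i])) :
    (rowRun r [i, i + 1, i]).1 = (rowRun r [i + 1, i, i + 1]).1 ∧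
      CKZ (rowRun r [i, i + 1, i]).2 (rowRun r [i + 1, i, i + 1]).2 := by
  have hi : i ∈ r → i + 1 ∈ r :=
    (Good.left (σ := word r ++ [i]) (b := [i + 1, i]) (by simpa using hg)).add_one_mem
  have hj : i + 1 ∈ r → i + 1 + 1 ∈ r := by
    have hg' := hg.congr ((CKZ.of_local (.braid i)).append_left (word r))
    exact (Good.left (σ := word r ++ [i + 1]) (b := [i, i + 1]) (by simpa using hg')).add_one_mem
  rcases exists_next r i with h | ⟨b, hb, hib, hbmin⟩
  · have e₁ : rowIns r i = (insert i r, []) := rowIns_none h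
    have e₂ : rowIns (insert i r) (i + 1) = (insert (i + 1) (insert i r), []) :=
      rowIns_none (by grind)
    have e₃ : rowIns (insert (i + 1) (insert i r)) i = (insert (i + 1) (insert i r), [i + 1]) :=
      rowIns_keep (by grind) (by grind) (by grind) (by grind)
    have f₁ : rowIns r (i + 1) = (insert (i + 1) r, []) := rowIns_none (by grind)
    have f₂ : rowIns (insert (i + 1) r) i = (insert i ((insert (i + 1) r).erase (i + 1)), [i + 1]) :=
      rowIns_bump (by grind) (by grind) (by grind) (by grind)
    have f₃ : rowIns (insert i ((insert (i + 1) r).erase (i + 1))) (i + 1) =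
        (insert (i + 1) (insert i ((insert (i + 1) r).erase (i + 1))), []) :=
      rowIns_none (by grind)
    simp only [rowRun, e₁, e₂, e₃, f₁, f₂, f₃]
    exact ⟨by ext a; grind, .refl _⟩
  by_cases hir : i ∈ r
  · have e₁ : rowIns r i = (r, [i + 1]) := rowIns_keep (hi hir) (by grind) (by grind) hir
    have e₂ : rowIns r (i + 1) = (r, [i + 1 + 1]) :=
      rowIns_keep (hj (hi hir)) (by grind) (by grind) (hi hir)
    simp only [rowRun, e₁, e₂, true_and]
    exact CKZ.of_local (.braid (i + 1))
  by_cases hbj : b = i + 1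
  · subst hbj
    have e₁ : rowIns r i = (insert i (r.erase (i + 1)), [i + 1]) := rowIns_bump hb hib hbmin hir
    have e₂ : rowIns (insert i (r.erase (i + 1))) (i + 1) =
        (insert (i + 1) ((insert i (r.erase (i + 1))).erase (i + 1 + 1)), [i + 1 + 1]) :=
      rowIns_bump (by grind) (by grind) (by grind) (by grind)
    have e₃ : rowIns (insert (i + 1) ((insert i (r.erase (i + 1))).erase (i + 1 + 1))) i =
        (insert (i + 1) ((insert i (r.erase (i + 1))).erase (i + 1 + 1)), [i + 1]) :=
      rowIns_keep (by grind) (by grind) (by grind) (by grind)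
    have f₁ : rowIns r (i + 1) = (r, [i + 1 + 1]) :=
      rowIns_keep (hj hb) (by grind) (by grind) hb
    simp only [rowRun, e₁, e₂, e₃, f₁, true_and]
    exact CKZ.of_local (.braid (i + 1))
  · have e₁ : rowIns r i = (insert i (r.erase b), [b]) := rowIns_bump hb hib hbmin hir
    have f₁ : rowIns r (i + 1) = (insert (i + 1) (r.erase b), [b]) :=
      rowIns_bump hb (by grind) (by grind) (by grind)
    have f₂ : rowIns (insert (i + 1) (r.erase b)) i =
        (insert i ((insert (i + 1) (r.erase b)).erase (i + 1)), [i + 1]) :=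
      rowIns_bump (by grind) (by grind) (by grind) (by grind)
    have f₂' : insert i ((insert (i + 1) (r.erase b)).erase (i + 1)) = insert i (r.erase b) := by
      ext a; grind
    rw [f₂'] at f₂
    rcases exists_next (insert i (r.erase b)) (i + 1) with h | ⟨c, hc, hjc, hcmin⟩
    · have e₂ := rowIns_none h
      have e₃ : rowIns (insert (i + 1) (insert i (r.erase b))) i =
          (insert (i + 1) (insert i (r.erase b)), [i + 1]) :=
        rowIns_keep (by grind) (by grind) (by grind) (by grind)
      simp only [rowRun, e₁, e₂, e₃, f₁, f₂, true_and]
      exact .refl _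
    · have e₂ := rowIns_bump hc hjc hcmin (by grind)
      have e₃ : rowIns (insert (i + 1) ((insert i (r.erase b)).erase c)) i =
          (insert (i + 1) ((insert i (r.erase b)).erase c), [i + 1]) :=
        rowIns_keep (by grind) (by grind) (by grind) (by grind)
      simp only [rowRun, e₁, e₂, e₃, f₁, f₂, true_and]
      exact (CKZ.of_local (.right (by grind) (by grind))).symm

theorem rowRun_local {r : Finset ℤ} {s t : List ℤ} (h : CKLocal s t) (hg : Good (word r ++ s)) :
    (rowRun r s).1 = (rowRun r t).1 ∧ CKZ (rowRun r s).2 (rowRun r t).2 := by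
  cases h with
  | right h₁ h₂ => exact rowRun_right h₁ h₂ hg
  | left h₁ h₂ => exact rowRun_left h₁ h₂ hg
  | braid i => exact rowRun_braid hg

/-- One-row Edelman–Greene insertion is compatible with Coxeter–Knuth equivalence. -/
theorem CKZ.rowRun {r : Finset ℤ} {u v : List ℤ} (h : CKZ u v) (hg : Good (word r ++ u)) :
    (rowRun r u).1 = (rowRun r v).1 ∧ CKZ (rowRun r u).2 (rowRun r v).2 := by
  induction h with
  | refl u => exact ⟨rfl, .refl _⟩
  | symm h ih =>
    obtain ⟨h₁, h₂⟩ := ih (hg.congr (h.symm.append_left _))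
    exact ⟨h₁.symm, h₂.symm⟩
  | trans h _ ih₁ ih₂ =>
    obtain ⟨h₁, h₂⟩ := ih₁ hg
    obtain ⟨h₃, h₄⟩ := ih₂ (hg.congr (h.append_left _))
    exact ⟨h₁.trans h₃, h₂.trans h₄⟩
  | step a b h =>
    rw [List.append_assoc] at hg
    obtain ⟨h₁, h₂⟩ := rowRun_local h
      (Good.left (b := b) (by simpa using hg.rowRun))
    simp only [rowRun_append, h₁, true_and]
    exact (h₂.append_left _).append_right _

theorem rowIns_mono {S S' : Finset ℤ} (h : S ⊆ S') (z : ℤ) :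
    (rowIns S z).1 ⊆ (rowIns S' z).1 := by
  rcases exists_next S z with h₁ | ⟨b, hb, hzb, hmin⟩ <;>
  rcases exists_next S' z with h₂ | ⟨b', hb', hzb', hmin'⟩
  · rw [rowIns_none h₁, rowIns_none h₂]
    exact Finset.insert_subset_insert _ h
  · rw [rowIns_none h₁, rowIns_some hb' hzb' hmin']
    intro a ha
    have := @h a
    grind
  · have := h₂ b (h hb)
    omega
  · rw [rowIns_some hb hzb hmin, rowIns_some hb' hzb' hmin']
    intro a ha
    have h₁ := @h a
    have h₂ := @h z
    grind

theorem rowRun_mono {S S' : Finset ℤ} (h : S ⊆ S') (w : List ℤ) :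
    (rowRun S w).1 ⊆ (rowRun S' w).1 := by
  induction w generalizing S S' with
  | nil => exact h
  | cons z w ih => exact ih (rowIns_mono h z)

theorem rowIns_mem {r : Finset ℤ} {z a : ℤ} (h : a ∈ (rowIns r z).1) : a = z ∨ a ∈ r := by
  rcases exists_next r z with h₁ | ⟨b, hb, hzb, hmin⟩
  · simpa [rowIns_none h₁] using h
  · rw [rowIns_some hb hzb hmin] at h
    grind

theorem rowIns_out {r : Finset ℤ} {z a : ℤ} (h : a ∈ (rowIns r z).2) : z < a ∧ a ∈ r := by
  rcases exists_next r z with h₁ | ⟨b, hb, hzb, hmin⟩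
  · simp [rowIns_none h₁] at h
  · rw [rowIns_some hb hzb hmin] at h
    grind

theorem rowRun_mem {r : Finset ℤ} {w : List ℤ} {a : ℤ}
    (h : a ∈ (rowRun r w).1 ∨ a ∈ (rowRun r w).2) : a ∈ r ∨ a ∈ w := by
  induction w generalizing r with
  | nil => simpa [rowRun] using h
  | cons z w ih =>
    simp only [rowRun, List.mem_append] at h
    have h₁ := @ih (rowIns r z).1
    have h₂ := @rowIns_mem r z a
    have h₃ := @rowIns_out r z a
    simp only [List.mem_cons]
    tauto

theorem rowRun_out {r : Finset ℤ} {w : List ℤ} {a : ℤ} (h : a ∈ (rowRun r w).2) :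
    ∃ z ∈ w, z < a := by
  induction w generalizing r with
  | nil => simp [rowRun] at h
  | cons z w ih =>
    simp only [rowRun, List.mem_append] at h
    rcases h with h | h
    · exact ⟨z, by simp, (rowIns_out h).1⟩
    · obtain ⟨y, hy, h'⟩ := ih h
      exact ⟨y, by simp [hy], h'⟩

theorem mem_rowRun_of_min {r : Finset ℤ} {w : List ℤ} {m : ℤ} (hm : ∀ z ∈ w, m ≤ z)
    (h : m ∈ r ∨ m ∈ w) : m ∈ (rowRun r w).1 := by
  induction w generalizing r with
  | nil => simpa [rowRun] using h
  | cons z w ih =>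
    refine ih (fun y hy => hm y (by simp [hy])) ?_
    rcases eq_or_ne m z with rfl | hne
    · exact .inl (mem_rowIns_self r m)
    · have hz := hm z (by simp)
      rcases h with h | h
      · left
        rcases exists_next r z with h₁ | ⟨b, hb, hzb, hmin⟩
        · simp [rowIns_none h₁, h]
        · rw [rowIns_some hb hzb hmin]
          grind
      · right
        simpa [hne] using h

/-! ### The first row and increasing subsequences -/

/-- The first row of the insertion tableau of a word. -/
def row (w : List ℤ) : Finset ℤ := (rowRun ∅ w).1

/-- The letters bumped out of the first row during the insertion of a word. -/
def out (w : List ℤ) : List ℤ := (rowRun ∅ w).2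

theorem row_concat (v : List ℤ) (x : ℤ) : row (v ++ [x]) = (rowIns (row v) x).1 := by
  simp [row, rowRun_append, rowRun]

theorem ckz_out_row {w : List ℤ} (h : Good w) : CKZ w (out w ++ word (row w)) := by
  simpa [word_empty, row, out] using ckz_rowRun (r := ∅) (w := w) (by simpa [word_empty] using h)

theorem CKZ.row_out {u v : List ℤ} (h : CKZ u v) (hg : Good u) :
    row u = row v ∧ CKZ (out u) (out v) :=
  h.rowRun (by simpa [word_empty] using hg)

theorem exists_sublist_of_mem_row {v : List ℤ} {z : ℤ} (hz : z ∈ row v) :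
    ∃ l : List ℤ, (l ++ [z]).Sublist v ∧ (l ++ [z]).Pairwise (· < ·) ∧
      l.length = ((row v).filter (· < z)).card := by
  induction v using List.reverseRecOn generalizing z with
  | nil => simp [row, rowRun] at hz
  | append_singleton v x ih =>
    rw [row_concat] at hz ⊢
    by_cases hzx : z = x
    · subst hzx
      have hf : (rowIns (row v) z).1.filter (· < z) = (row v).filter (· < z) := by
        rcases exists_next (row v) z with h₁ | ⟨b, hb, hzb, hmin⟩
        · rw [rowIns_none h₁]
          ext a
          grind
        · rw [rowIns_some hb hzb hmin]
          ext a
          grind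
      rw [hf]
      by_cases hne : ((row v).filter (· < z)).Nonempty
      · obtain ⟨y, hy, hymax⟩ := Finset.exists_max_image _ id hne
        simp only [Finset.mem_filter, id] at hy hymax
        obtain ⟨l, hl, hp, hlen⟩ := ih hy.1
        refine ⟨l ++ [y], hl.append (List.Sublist.refl _), ?_, ?_⟩
        · rw [List.pairwise_append] at hp ⊢
          refine ⟨List.pairwise_append.2 hp, by simp, ?_⟩
          have := hp.2.2
          grind
        · have : (row v).filter (· < z) = insert y ((row v).filter (· < y)) := by
            ext a
            grind
          rw [this, Finset.card_insert_of_notMem (by simp), List.length_append, hlen]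
          rfl
      · rw [Finset.not_nonempty_iff_eq_empty] at hne
        exact ⟨[], by simp, by simp, by simp [hne]⟩
    · have hzr := (rowIns_mem hz).resolve_left hzx
      obtain ⟨l, hl, hp, hlen⟩ := ih hzr
      refine ⟨l, hl.trans (List.sublist_append_left _ _), hp, hlen.trans ?_⟩
      rcases exists_next (row v) x with h₁ | ⟨b, hb, hzb, hmin⟩
      · rw [rowIns_none h₁]
        congr 1
        ext a
        grind
      · rw [rowIns_some hb hzb hmin] at hz ⊢
        split_ifs with hx
        · rfl
        · rw [if_neg hx] at hz
          rcases lt_or_ge z x with h | h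
          · congr 1
            ext a
            grind
          · have : (insert x ((row v).erase b)).filter (· < z) =
                insert x (((row v).filter (· < z)).erase b) := by
              ext a
              grind
            have hbf : b ∈ (row v).filter (· < z) := by grind
            rw [this, Finset.card_insert_of_notMem (by grind),
              Finset.card_erase_add_one hbf]

theorem insert_filter_lt_subset_rowIns (r : Finset ℤ) (z : ℤ) :
    insert z (r.filter (· < z)) ⊆ (rowIns r z).1.filter (· ≤ z) := by
  rcases exists_next r z with h | ⟨b, hb, hxb, hmin⟩
  · rw [rowIns_none h]
    intro a
    grind
  · rw [rowIns_some hb hxb hmin]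
    intro a
    grind

theorem length_le_of_sublist {v l : List ℤ} {z : ℤ} (hl : (l ++ [z]).Sublist v)
    (hp : (l ++ [z]).Pairwise (· < ·)) : l.length + 1 ≤ ((row v).filter (· ≤ z)).card := by
  induction v using List.reverseRecOn generalizing l z with
  | nil => simp at hl
  | append_singleton v x ih =>
    rw [row_concat]
    obtain ⟨l₁, l₂, heq, h₁, h₂⟩ := List.sublist_append_iff.1 hl
    have hl₂ : l₂ = [] ∨ l₂ = [x] := by
      cases h₂ with
      | cons _ h => exact .inl (List.sublist_nil.1 h)
      | cons_cons _ h => exact .inr (by rw [List.sublist_nil.1 h])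
    rcases hl₂ with rfl | rfl
    · rw [List.append_nil] at heq
      subst heq
      refine (ih h₁ hp).trans ?_
      rcases exists_next (row v) x with h | ⟨b, hb, hxb, hmin⟩
      · rw [rowIns_none h]
        exact Finset.card_le_card (by intro a; grind)
      · rw [rowIns_some hb hxb hmin]
        split_ifs with hx
        · rfl
        · rcases lt_or_ge z b with h | h
          · exact Finset.card_le_card (by intro a; grind)
          · have : (insert x ((row v).erase b)).filter (· ≤ z) =
                insert x (((row v).filter (· ≤ z)).erase b) := by
              ext a
              grind
            have hbf : b ∈ (row v).filter (· ≤ z) := by grind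
            rw [this, Finset.card_insert_of_notMem (by grind), Finset.card_erase_add_one hbf]
    · obtain ⟨rfl, hzx⟩ := List.append_inj' heq rfl
      obtain rfl : z = x := by simpa using hzx
      refine le_trans ?_ (Finset.card_le_card (insert_filter_lt_subset_rowIns (row v) z))
      rw [Finset.card_insert_of_notMem (by simp)]
      rcases List.eq_nil_or_concat l with rfl | ⟨l', y, rfl⟩
      · simp
      · rw [List.concat_eq_append] at *
        have h₃ := ih h₁ (List.pairwise_append.1 hp).1
        have hyz : y < z := (List.pairwise_append.1 hp).2.2 y (by simp) z (by simp)
        have h₄ : (row v).filter (· ≤ y) ⊆ (row v).filter (· < z) := by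
          intro a
          grind
        have := Finset.card_le_card h₄
        simp only [List.length_append, List.length_singleton]
        omega

theorem length_le_card_row {v l : List ℤ} (hl : l.Sublist v) (hp : l.Pairwise (· < ·)) :
    l.length ≤ (row v).card := by
  rcases List.eq_nil_or_concat l with rfl | ⟨l', z, rfl⟩
  · simp
  · rw [List.concat_eq_append] at *
    have := length_le_of_sublist hl hp
    have := Finset.card_filter_le (row v) (· ≤ z)
    simp only [List.length_append, List.length_singleton]
    omega

theorem exists_sublist_card_row (v : List ℤ) :
    ∃ l : List ℤ, l.Sublist v ∧ l.Pairwise (· < ·) ∧ l.length = (row v).card := by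
  by_cases hne : (row v).Nonempty
  · obtain ⟨z, hz, hmax⟩ := Finset.exists_max_image _ id hne
    obtain ⟨l, hl, hp, hlen⟩ := exists_sublist_of_mem_row hz
    refine ⟨l ++ [z], hl, hp, ?_⟩
    have : row v = insert z ((row v).filter (· < z)) := by
      ext a
      simp only [id] at hmax
      grind
    rw [this, Finset.card_insert_of_notMem (by simp), List.length_append, hlen]
    rfl
  · rw [Finset.not_nonempty_iff_eq_empty] at hne
    exact ⟨[], by simp, by simp, by simp [hne]⟩

theorem card_row_reverse (w : List ℤ) : (row w.reverse).card = (row (w.map (- ·))).card := by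
  apply le_antisymm
  · obtain ⟨l, hl, hp, hlen⟩ := exists_sublist_card_row w.reverse
    rw [← hlen]
    have h₁ : (l.reverse.map (- ·)).Sublist (w.map (- ·)) := by
      have := hl.reverse.map (- ·)
      simpa using this
    have h₂ : (l.reverse.map (- ·)).Pairwise (· < ·) := by
      rw [List.pairwise_map, List.pairwise_reverse]
      simpa using hp
    simpa using length_le_card_row h₁ h₂
  · obtain ⟨l, hl, hp, hlen⟩ := exists_sublist_card_row (w.map (- ·))
    rw [← hlen]
    have h₁ : (l.reverse.map (- ·)).Sublist w.reverse := by
      have := (hl.map (- ·)).reverse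
      simpa using this
    have h₂ : (l.reverse.map (- ·)).Pairwise (· < ·) := by
      rw [List.pairwise_map, List.pairwise_reverse]
      simpa using hp
    simpa using length_le_card_row h₁ h₂

theorem card_row_append_le {D v : List ℤ} (hD : D.Pairwise (· > ·)) :
    (row (D ++ v)).card ≤ (row v).card + 1 := by
  obtain ⟨l, hl, hp, hlen⟩ := exists_sublist_card_row (D ++ v)
  obtain ⟨l₁, l₂, rfl, h₁, h₂⟩ := List.sublist_append_iff.1 hl
  rw [List.pairwise_append] at hp
  have h₃ := length_le_card_row h₂ hp.2.1
  have h₄ : l₁.length ≤ 1 := by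
    have h := hD.sublist h₁
    rcases l₁ with _ | ⟨a, _ | ⟨b, l⟩⟩
    · simp
    · simp
    · have h' := hp.1
      simp only [List.pairwise_cons, List.mem_cons, forall_eq_or_imp] at h h'
      have := h.1.1
      have := h'.1.1
      omega
  rw [← hlen, List.length_append]
  omega

/-! ### Left keys of a word -/

/-- The word left after removing a maximal decreasing factor on the right of a word. -/
def peel (x : List ℤ) : List ℤ := (out (x.map (- ·))).map (- ·)

/-- The first row obtained when a word is inserted from right to left, after `t` peelings. -/
def leftKey (t : ℕ) (x : List ℤ) : Finset ℤ := row (peel^[t] x).reverse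

theorem peel_append (p q : List ℤ) : peel p <+: peel (p ++ q) := by
  simp [peel, out, rowRun_append]

theorem iterate_peel_prefix {p x : List ℤ} (h : p <+: x) (t : ℕ) : peel^[t] p <+: peel^[t] x := by
  induction t generalizing p x with
  | zero => exact h
  | succ t ih =>
    obtain ⟨q, rfl⟩ := h
    exact ih (peel_append p q)

theorem leftKey_subset_of_prefix {p x : List ℤ} (h : p <+: x) (t : ℕ) :
    leftKey t p ⊆ leftKey t x := by
  obtain ⟨q, hq⟩ := iterate_peel_prefix h t
  rw [leftKey, leftKey, ← hq, List.reverse_append, row, row, rowRun_append]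
  exact rowRun_mono (Finset.empty_subset _) _

theorem mem_of_mem_leftKey {x : List ℤ} {t : ℕ} {a : ℤ} (h : a ∈ leftKey t x) :
    a ∈ peel^[t] x := by
  have := rowRun_mem (.inl h)
  simpa using this

theorem mem_of_mem_peel {x : List ℤ} {a : ℤ} (h : a ∈ peel x) : a ∈ x := by
  obtain ⟨b, hb, rfl⟩ := List.mem_map.1 h
  have := rowRun_mem (.inr hb)
  simp only [Finset.notMem_empty, List.mem_map, false_or] at this
  obtain ⟨c, hc, rfl⟩ := this
  simpa using hc

theorem mem_of_mem_iterate_peel {x : List ℤ} {t : ℕ} {a : ℤ} (h : a ∈ peel^[t] x) : a ∈ x := by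
  induction t generalizing x with
  | zero => exact h
  | succ t ih => exact mem_of_mem_peel (ih h)

theorem ckz_peel {x : List ℤ} (h : Good x) :
    CKZ x (peel x ++ (word (row (x.map (- ·)))).map (- ·)) := by
  have := (ckz_out_row h.map_neg).map_neg
  simpa [peel] using this

theorem CKZ.peel {x y : List ℤ} (h : CKZ x y) (hg : Good x) : CKZ (peel x) (peel y) :=
  (h.map_neg.row_out hg.map_neg).2.map_neg

theorem Good.peel {x : List ℤ} (h : Good x) : Good (peel x) :=
  (h.congr (ckz_peel h)).left

theorem Good.iterate_peel {x : List ℤ} (h : Good x) (t : ℕ) : Good (_root_.peel^[t] x) := by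
  induction t generalizing x with
  | zero => exact h
  | succ t ih => exact ih h.peel

theorem CKZ.iterate_peel {x y : List ℤ} (h : CKZ x y) (hg : Good x) (t : ℕ) :
    CKZ (_root_.peel^[t] x) (_root_.peel^[t] y) := by
  induction t generalizing x y with
  | zero => exact h
  | succ t ih => exact ih (h.peel hg) hg.peel

theorem CKZ.leftKey_eq {x y : List ℤ} (h : CKZ x y) (hg : Good x) (t : ℕ) :
    leftKey t x = leftKey t y :=
  ((h.iterate_peel hg t).reverse.row_out (hg.iterate_peel t).reverse).1

theorem length_peel {x : List ℤ} (h : Good x) :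
    (peel x).length + (leftKey 0 x).card = x.length := by
  rw [leftKey, Function.iterate_zero, id, card_row_reverse, (ckz_peel h).length_eq]
  simp [length_word]

theorem length_iterate_peel {x : List ℤ} (h : Good x) (N : ℕ) :
    (peel^[N] x).length + ∑ t ∈ Finset.range N, (leftKey t x).card = x.length := by
  induction N with
  | zero => simp
  | succ N ih =>
    rw [Finset.sum_range_succ, Function.iterate_succ_apply']
    have := length_peel (h.iterate_peel N)
    simp only [leftKey, Function.iterate_zero, id] at this ih ⊢
    omega

theorem exists_mem_forall_le {x : List ℤ} (h : x ≠ []) : ∃ m ∈ x, ∀ z ∈ x, m ≤ z := by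
  obtain ⟨m, hm, hmin⟩ := x.toFinset.exists_min_image id
    (by simpa [List.toFinset_nonempty_iff] using h)
  exact ⟨m, by simpa using hm, fun z hz => hmin z (by simpa using hz)⟩

theorem mem_leftKey_of_min {x : List ℤ} {t : ℕ} {m : ℤ} (hm : ∀ z ∈ x, m ≤ z)
    (h : m ∈ peel^[t] x) : m ∈ leftKey t x :=
  mem_rowRun_of_min (fun z hz => hm z (mem_of_mem_iterate_peel (t := t) (by simpa using hz)))
    (.inr (by simpa using h))

theorem length_iterate_peel_le {x : List ℤ} (h : Good x) (N : ℕ) :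
    (peel^[N] x).length ≤ x.length - N := by
  induction N with
  | zero => simp
  | succ N ih =>
    rw [Function.iterate_succ_apply']
    by_cases hne : peel^[N] x = []
    · rw [hne]
      simp [peel, out, rowRun]
    · have h₁ := length_peel (h.iterate_peel N)
      obtain ⟨m, hm, hmin⟩ := exists_mem_forall_le hne
      have : 0 < (leftKey 0 (peel^[N] x)).card :=
        Finset.card_pos.2 ⟨m, mem_leftKey_of_min (t := 0) hmin hm⟩
      omega

theorem sum_card_leftKey {x : List ℤ} (h : Good x) {N : ℕ} (hN : x.length ≤ N) :
    ∑ t ∈ Finset.range N, (leftKey t x).card = x.length := by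
  have h₁ := length_iterate_peel h N
  have h₂ := length_iterate_peel_le h N
  omega

/-- The number of entries larger than `k` in the first `N` left keys of a word. -/
def keyCount (N : ℕ) (k : ℤ) (x : List ℤ) : ℕ :=
  ∑ t ∈ Finset.range N, ((leftKey t x).filter (k < ·)).card

theorem keyCount_of_forall_lt {x : List ℤ} {k : ℤ} {N : ℕ} (h : Good x) (hN : x.length ≤ N)
    (hk : ∀ a ∈ x, k < a) : keyCount N k x = x.length := by
  rw [← sum_card_leftKey h hN]
  refine Finset.sum_congr rfl fun t _ => ?_
  rw [Finset.filter_true_of_mem]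
  exact fun a ha => hk a (mem_of_mem_iterate_peel (mem_of_mem_leftKey ha))

/-- A prefix with large letters of a word in the class of `x` is bounded in terms of `x`. -/
theorem length_prefix_le_keyCount {x σ p : List ℤ} {k : ℤ} {N : ℕ} (h : Good x)
    (hσ : CKZ x σ) (hp : p <+: σ) (hk : ∀ a ∈ p, k < a) (hN : x.length ≤ N) :
    p.length ≤ keyCount N k x := by
  obtain ⟨q, hq⟩ := id hp
  have hgp : Good p := (hq ▸ h.congr hσ : Good (p ++ q)).left
  have hlen : p.length ≤ N := hp.length_le.trans (hσ.length_eq ▸ hN)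
  rw [← keyCount_of_forall_lt hgp hlen hk]
  refine Finset.sum_le_sum fun t _ => Finset.card_le_card ?_
  rw [hσ.leftKey_eq h]
  exact Finset.filter_subset_filter _ (leftKey_subset_of_prefix hp t)

theorem exists_ckz_iterate_peel {x : List ℤ} (h : Good x) (s : ℕ) :
    ∃ ρ, CKZ x (peel^[s] x ++ ρ) ∧ (row ρ).card ≤ s := by
  induction s with
  | zero => exact ⟨[], by simpa using CKZ.refl x, by simp [row, rowRun]⟩
  | succ s ih =>
    obtain ⟨ρ, hρ, hc⟩ := ih
    refine ⟨(word (row ((peel^[s] x).map (- ·)))).map (- ·) ++ ρ, ?_, ?_⟩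
    · rw [Function.iterate_succ_apply', ← List.append_assoc]
      exact hρ.trans ((ckz_peel (h.iterate_peel s)).append_right ρ)
    · refine (card_row_append_le ?_).trans (by omega)
      rw [List.pairwise_map]
      exact (pairwise_word _).imp fun h => by simpa using h

/-- Splitting off the block that starts with the smallest letter. -/
theorem exists_split_min {x : List ℤ} {m : ℤ} (h : Good x) (hm : m ∈ x) (hmin : ∀ z ∈ x, m ≤ z) :
    ∃ (p : List ℤ) (R : Finset ℤ), CKZ x (p ++ word R) ∧ m ∈ R ∧ m ∉ p ∧
      ∀ t N, t < N → x.length ≤ N → leftKey t p = (leftKey t x).erase m := by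
  classical
  have hex : ∃ s, m ∉ peel^[s] x := by
    refine ⟨x.length, ?_⟩
    have := length_iterate_peel_le h x.length
    have h0 : peel^[x.length] x = [] := List.length_eq_zero_iff.1 (by omega)
    simp [h0]
  obtain ⟨ρ, hρ, hcard⟩ := exists_ckz_iterate_peel h (Nat.find hex)
  set s := Nat.find hex with hs
  have hsm : m ∉ peel^[s] x := Nat.find_spec hex
  have hlt : ∀ t < s, m ∈ peel^[t] x := fun t ht => by
    simpa using Nat.find_min hex ht
  have hsl : s ≤ x.length := Nat.find_min' hex (by
    have := length_iterate_peel_le h x.length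
    have h0 : peel^[x.length] x = [] := List.length_eq_zero_iff.1 (by omega)
    simp [h0])
  have hgρ : Good ρ := (h.congr hρ).right
  have hck : CKZ x (peel^[s] x ++ out ρ ++ word (row ρ)) := by
    simpa using hρ.trans ((ckz_out_row hgρ).append_left _)
  have hout : m ∉ out ρ := fun hmo => by
    obtain ⟨z, hz, hzm⟩ := rowRun_out hmo
    have := hmin z ((hρ.mem_iff z).2 (by simp [hz]))
    omega
  have hmp : m ∉ peel^[s] x ++ out ρ := by simp [hsm, hout]
  refine ⟨peel^[s] x ++ out ρ, row ρ, hck, ?_, hmp, ?_⟩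
  · have := (hck.mem_iff m).1 hm
    rw [List.mem_append, mem_word] at this
    exact this.resolve_left hmp
  intro t N ht hN
  set p := peel^[s] x ++ out ρ with hp
  have hgp : Good p := (h.congr hck).left
  have hlen : x.length = p.length + (row ρ).card := by
    rw [hck.length_eq, List.length_append, length_word]
  have hsub : ∀ t ∈ Finset.range N, leftKey t p ⊆ (leftKey t x).erase m := fun t _ a ha => by
    rw [Finset.mem_erase]
    refine ⟨?_, ?_⟩
    · rintro rfl
      exact hmp (mem_of_mem_iterate_peel (mem_of_mem_leftKey ha))
    · rw [hck.leftKey_eq h]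
      exact leftKey_subset_of_prefix (List.prefix_append _ _) t ha
  have hsum : ∑ t ∈ Finset.range N, ((leftKey t x).erase m).card + s ≤ x.length := by
    rw [← sum_card_leftKey h hN]
    have : s = ∑ t ∈ Finset.range N, if t < s then 1 else 0 := by
      rw [Finset.sum_boole]
      have : (Finset.range N).filter (· < s) = Finset.range s := by
        ext a
        simp only [Finset.mem_filter, Finset.mem_range]
        omega
      rw [this]
      simp
    conv_lhs => rw [this]
    rw [← Finset.sum_add_distrib]
    refine Finset.sum_le_sum fun t _ => ?_
    split_ifs with hts
    · rw [Finset.card_erase_add_one (mem_leftKey_of_min hmin (hlt t hts))]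
    · exact Finset.card_le_card (Finset.erase_subset _ _)
  have hle : ∀ t ∈ Finset.range N, (leftKey t p).card ≤ ((leftKey t x).erase m).card :=
    fun t ht => Finset.card_le_card (hsub t ht)
  have heq : ∑ t ∈ Finset.range N, (leftKey t p).card =
      ∑ t ∈ Finset.range N, ((leftKey t x).erase m).card := by
    refine le_antisymm (Finset.sum_le_sum hle) ?_
    rw [sum_card_leftKey hgp (by omega)]
    omega
  have htN : t ∈ Finset.range N := Finset.mem_range.2 ht
  exact Finset.eq_of_subset_of_card_le (hsub t htN)
    ((Finset.sum_eq_sum_iff_of_le hle).1 heq t htN).ge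

theorem headI_word {R : Finset ℤ} {m : ℤ} (hm : m ∈ R) (hmin : ∀ z ∈ R, m ≤ z) :
    (word R).headI = m := by
  have hp := pairwise_word R
  have hmw : m ∈ word R := mem_word.2 hm
  rcases hw : word R with _ | ⟨a, l⟩
  · simp [hw] at hmw
  · have ha : m ≤ a := hmin a (mem_word.1 (by simp [hw]))
    rw [hw] at hp hmw
    rcases List.mem_cons.1 hmw with h | h
    · simp [h]
    · have := (List.pairwise_cons.1 hp).1 m h
      omega

/-- Every class contains a concatenation of increasing blocks with decreasing first letters whose
number of letters in blocks with first letter larger than `k` is given by the left keys. -/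
theorem exists_blocks (x : List ℤ) (h : Good x) : ∃ bs : List (List ℤ),
    (∀ b ∈ bs, b ≠ [] ∧ b.Pairwise (· < ·)) ∧ (bs.map List.headI).Pairwise (· > ·) ∧
    CKZ x bs.flatten ∧
    ∀ (k : ℤ) (N : ℕ), x.length ≤ N →
      (bs.filter (fun b => k < b.headI)).flatten.length = keyCount N k x := by
  induction hn : x.length using Nat.strong_induction_on generalizing x with
  | _ n ih =>
  subst hn
  by_cases hx : x = []
  · subst hx
    refine ⟨[], by simp, by simp, .refl _, fun k N _ => ?_⟩
    have : keyCount N k [] = 0 := by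
      have h₁ := keyCount_of_forall_lt h (Nat.zero_le N) (k := k) (by simp)
      simpa using h₁
    simp [this]
  obtain ⟨m, hm, hmin⟩ := exists_mem_forall_le hx
  obtain ⟨p, R, hck, hmR, hmp, hkey⟩ := exists_split_min h hm hmin
  have hlen : x.length = p.length + R.card := by
    rw [hck.length_eq, List.length_append, length_word]
  have hR : 0 < R.card := Finset.card_pos.2 ⟨m, hmR⟩
  have hgp : Good p := (h.congr hck).left
  obtain ⟨bs, hbs, hheads, hckp, hcount⟩ := ih p.length (by omega) p hgp rfl
  have hmem : ∀ b ∈ bs, b.headI ∈ p := fun b hb => by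
    rw [hckp.mem_iff, List.mem_flatten]
    refine ⟨b, hb, ?_⟩
    have := (hbs b hb).1
    cases b with
    | nil => exact absurd rfl this
    | cons a l => simp
  have hmlt : ∀ b ∈ bs, m < b.headI := fun b hb => by
    have h₁ := hmem b hb
    have h₂ := hmin _ ((hck.mem_iff _).2 (List.mem_append_left _ h₁))
    exact lt_of_le_of_ne h₂ (fun h => hmp (h ▸ h₁))
  have hhead : (word R).headI = m :=
    headI_word hmR fun z hz => hmin z ((hck.mem_iff z).2 (by simp [mem_word, hz]))
  refine ⟨bs ++ [word R], ?_, ?_, ?_, ?_⟩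
  · intro b hb
    rcases List.mem_append.1 hb with hb | hb
    · exact hbs b hb
    · rw [List.mem_singleton.1 hb]
      refine ⟨fun h => ?_, pairwise_word R⟩
      rw [← mem_word, h] at hmR
      simp at hmR
  · rw [List.map_append, List.pairwise_append]
    refine ⟨hheads, by simp, ?_⟩
    simp only [List.mem_map, List.map_cons, List.map_nil, List.mem_singleton, forall_eq, hhead]
    rintro _ ⟨b, hb, rfl⟩
    exact hmlt b hb
  · rw [List.flatten_append]
    simpa using hck.trans (hckp.append_right (word R))
  · intro k N hN
    rcases lt_or_ge k m with hkm | hkm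
    · rw [keyCount_of_forall_lt h hN (fun a ha => hkm.trans_le (hmin a ha)),
        List.filter_eq_self.2, List.flatten_append, List.length_append, ← hckp.length_eq, hlen]
      · simp [length_word]
      · intro b hb
        rcases List.mem_append.1 hb with hb | hb
        · exact decide_eq_true (hkm.trans (hmlt b hb))
        · rw [List.mem_singleton.1 hb, hhead]
          exact decide_eq_true hkm
    · rw [List.filter_append, List.filter_cons_of_neg (by rw [hhead]; simpa using hkm),
        List.filter_nil, List.append_nil, hcount k N (by omega)]
      refine Finset.sum_congr rfl fun t ht => ?_
      rw [hkey t N (Finset.mem_range.1 ht) hN, Finset.filter_erase, Finset.erase_eq_of_notMem]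
      simp only [Finset.mem_filter, not_and]
      omega

/-! ### Reduced words of positive integers -/

theorem sPerm_mul_comm {i j : ℕ} (h : i + 2 ≤ j) : sPerm i * sPerm j = sPerm j * sPerm i := by
  ext k
  simp only [sPerm, Equiv.Perm.mul_apply, Equiv.swap_apply_def]
  split_ifs <;> omega

theorem sPerm_braid (i : ℕ) :
    sPerm i * (sPerm (i + 1) * sPerm i) = sPerm (i + 1) * (sPerm i * sPerm (i + 1)) := by
  ext k
  simp only [sPerm, Equiv.Perm.mul_apply, Equiv.swap_apply_def]
  split_ifs <;> omega

theorem wordPerm_append (u v : List ℕ) : wordPerm (u ++ v) = wordPerm u * wordPerm v := by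
  simp [wordPerm]

theorem CKStep.wordPerm_eq {u v : List ℕ} (h : CKStep u v) : wordPerm u = wordPerm v := by
  rcases h with ⟨a, b, x, y, z, h₁, h₂, rfl, rfl⟩ | ⟨a, b, x, y, z, h₁, h₂, rfl, rfl⟩ |
    ⟨a, b, i, rfl, rfl⟩
  · simp only [wordPerm_append]
    congr 2
    simp [wordPerm, sPerm_mul_comm (show y + 2 ≤ z by omega)]
  · simp only [wordPerm_append]
    congr 2
    simp only [wordPerm, List.map_cons, List.map_nil, List.prod_cons, List.prod_nil, mul_one,
      ← mul_assoc, sPerm_mul_comm (show y + 2 ≤ x by omega)]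
  · simp only [wordPerm_append]
    congr 2
    simpa [wordPerm] using sPerm_braid i

theorem CKStep.length_eq {u v : List ℕ} (h : CKStep u v) : u.length = v.length := by
  rcases h with ⟨a, b, x, y, z, h₁, h₂, rfl, rfl⟩ | ⟨a, b, x, y, z, h₁, h₂, rfl, rfl⟩ |
    ⟨a, b, i, rfl, rfl⟩ <;> simp

theorem CKStep.mem_iff {u v : List ℕ} (h : CKStep u v) (c : ℕ) : c ∈ u ↔ c ∈ v := by
  rcases h with ⟨a, b, x, y, z, h₁, h₂, rfl, rfl⟩ | ⟨a, b, x, y, z, h₁, h₂, rfl, rfl⟩ |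
    ⟨a, b, i, rfl, rfl⟩ <;> simp <;> tauto

theorem CKStep.ckz {u v : List ℕ} (h : CKStep u v) :
    CKZ (u.map Nat.cast) (v.map Nat.cast) := by
  rcases h with ⟨a, b, x, y, z, h₁, h₂, rfl, rfl⟩ | ⟨a, b, x, y, z, h₁, h₂, rfl, rfl⟩ |
    ⟨a, b, i, rfl, rfl⟩
  · simp only [List.map_append]
    exact .step _ _ (.right (by exact_mod_cast h₁) (by exact_mod_cast h₂))
  · simp only [List.map_append]
    exact .step _ _ (.left (by exact_mod_cast h₁) (by exact_mod_cast h₂))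
  · simp only [List.map_append, List.map_cons, List.map_nil, Nat.cast_add, Nat.cast_one]
    exact .step _ _ (.braid i)

namespace CKEquiv

theorem symm {u v : List ℕ} (h : CKEquiv u v) : CKEquiv v u := Relation.EqvGen.symm _ _ h

theorem trans {u v w : List ℕ} (h : CKEquiv u v) (h' : CKEquiv v w) : CKEquiv u w :=
  Relation.EqvGen.trans _ _ _ h h'

theorem wordPerm_eq {u v : List ℕ} (h : CKEquiv u v) : wordPerm u = wordPerm v := by
  induction h with
  | rel _ _ h => exact h.wordPerm_eq
  | refl _ => rfl
  | symm _ _ _ ih => exact ih.symm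
  | trans _ _ _ _ _ ih₁ ih₂ => exact ih₁.trans ih₂

theorem length_eq {u v : List ℕ} (h : CKEquiv u v) : u.length = v.length := by
  induction h with
  | rel _ _ h => exact h.length_eq
  | refl _ => rfl
  | symm _ _ _ ih => exact ih.symm
  | trans _ _ _ _ _ ih₁ ih₂ => exact ih₁.trans ih₂

theorem mem_iff {u v : List ℕ} (h : CKEquiv u v) (c : ℕ) : c ∈ u ↔ c ∈ v := by
  induction h with
  | rel _ _ h => exact h.mem_iff c
  | refl _ => rfl
  | symm _ _ _ ih => exact ih.symm
  | trans _ _ _ _ _ ih₁ ih₂ => exact ih₁.trans ih₂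

theorem ckz {u v : List ℕ} (h : CKEquiv u v) : CKZ (u.map Nat.cast) (v.map Nat.cast) := by
  induction h with
  | rel _ _ h => exact h.ckz
  | refl _ => exact .refl _
  | symm _ _ _ ih => exact ih.symm
  | trans _ _ _ _ _ ih₁ ih₂ => exact ih₁.trans ih₂

theorem posWord {u v : List ℕ} (h : CKEquiv u v) (hu : PosWord u) : PosWord v :=
  fun x hx => hu x ((h.mem_iff x).2 hx)

theorem isReducedWord {u v : List ℕ} (h : CKEquiv u v) (hu : IsReducedWord u) :
    IsReducedWord v := by
  refine ⟨h.posWord hu.1, fun σ hσ hp => ?_⟩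
  rw [← h.length_eq]
  exact hu.2 σ hσ (hp.trans h.wordPerm_eq.symm)

end CKEquiv

theorem CKZ.ckEquiv_toNat {x y : List ℤ} (h : CKZ x y) (hx : ∀ a ∈ x, 0 ≤ a) :
    CKEquiv (x.map Int.toNat) (y.map Int.toNat) := by
  induction h with
  | refl u => exact Relation.EqvGen.refl _
  | symm h ih => exact (ih fun a ha => hx a ((h.mem_iff a).1 ha)).symm
  | trans h _ ih₁ ih₂ => exact (ih₁ hx).trans (ih₂ fun a ha => hx a ((h.mem_iff a).2 ha))
  | step a b h =>
    refine Relation.EqvGen.rel _ _ ?_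
    simp only [List.map_append]
    cases h with
    | @right x y z h₁ h₂ =>
      have := hx y (by simp)
      exact .inl ⟨_, _, x.toNat, y.toNat, z.toNat, by omega, by omega, rfl, rfl⟩
    | @left x y z h₁ h₂ =>
      have := hx y (by simp)
      exact .inr (.inl ⟨_, _, x.toNat, y.toNat, z.toNat, by omega, by omega, rfl, rfl⟩)
    | braid i =>
      have := hx i (by simp)
      have hi : (i + 1).toNat = i.toNat + 1 := by omega
      exact .inr (.inr ⟨a.map Int.toNat, b.map Int.toNat, i.toNat, by simp [hi], by simp [hi]⟩)

theorem map_toNat_cast (u : List ℕ) : (u.map (Nat.cast : ℕ → ℤ)).map Int.toNat = u := by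
  simp [Function.comp_def]

theorem IsReducedWord.factor {a u b : List ℕ} (h : IsReducedWord (a ++ u ++ b)) :
    IsReducedWord u := by
  refine ⟨fun x hx => h.1 x (by simp [hx]), fun σ hσ hp => ?_⟩
  have := h.2 (a ++ σ ++ b) (fun x hx => ?_) (by simp only [wordPerm_append, hp])
  · simp only [List.length_append] at this
    omega
  · simp only [List.mem_append] at hx
    rcases hx with (hx | hx) | hx
    · exact h.1 x (by simp [hx])
    · exact hσ x hx
    · exact h.1 x (by simp [hx])

theorem sPerm_mul_wordPerm {z : ℕ} {u : List ℕ} (h : ∀ c ∈ u, c + 2 ≤ z ∨ z + 2 ≤ c) :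
    sPerm z * wordPerm u = wordPerm u * sPerm z := by
  induction u with
  | nil => simp [wordPerm]
  | cons c u ih =>
    have hc : sPerm z * sPerm c = sPerm c * sPerm z := by
      rcases h c (by simp) with h | h
      · exact (sPerm_mul_comm h).symm
      · exact sPerm_mul_comm h
    have hu := ih fun d hd => h d (by simp [hd])
    have hcu : wordPerm (c :: u) = sPerm c * wordPerm u := by simp [wordPerm]
    rw [hcu, ← mul_assoc, hc, mul_assoc, hu, mul_assoc]

theorem IsReducedWord.exists_near {a u b : List ℕ} {z : ℕ}
    (h : IsReducedWord (a ++ z :: u ++ z :: b)) : ∃ c ∈ u, z ≤ c + 1 ∧ c ≤ z + 1 := by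
  by_contra! hc
  have hz := sPerm_mul_wordPerm (z := z) (u := u) fun c hcu => by
    have := hc c hcu
    omega
  have hzz : sPerm z * sPerm z = 1 := Equiv.swap_mul_self _ _
  have := h.2 (a ++ u ++ b) (fun x hx => h.1 x (by simp at hx ⊢; tauto)) (by
    have e : a ++ z :: u ++ z :: b = a ++ ([z] ++ u ++ [z]) ++ b := by simp
    have hwz : wordPerm [z] = sPerm z := by simp [wordPerm]
    rw [e]
    simp only [wordPerm_append, hwz, hz]
    rw [mul_assoc (wordPerm u), hzz, mul_one])
  simp at this

theorem IsReducedWord.good {u : List ℕ} (h : IsReducedWord u) : Good (u.map Nat.cast) := by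
  rintro τ hτ a b v z rfl
  have hnn : ∀ c ∈ u.map (Nat.cast : ℕ → ℤ), 0 ≤ c := by simp
  have hck := hτ.ckEquiv_toNat hnn
  rw [map_toNat_cast] at hck
  have hr := hck.isReducedWord h
  simp only [List.map_append, List.map_cons] at hr
  obtain ⟨c, hc, h₁, h₂⟩ := hr.exists_near
  obtain ⟨d, hd, rfl⟩ := List.mem_map.1 hc
  have hd0 := hnn d ((hτ.mem_iff d).2 (by simp [hd]))
  have hz0 := hnn z ((hτ.mem_iff z).2 (by simp))
  exact ⟨d, hd, by omega, by omega⟩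

theorem headI_map_toNat (b : List ℤ) : (b.map Int.toNat).headI = b.headI.toNat := by
  cases b <;> rfl

/-- Every class of reduced words contains a concatenation of increasing blocks with decreasing
first letters that bounds all prefixes with large letters of words in the class. -/
theorem IsReducedWord.exists_blocks {u : List ℕ} (h : IsReducedWord u) : ∃ bs : List (List ℕ),
    (∀ b ∈ bs, b ≠ [] ∧ b.Pairwise (· < ·)) ∧ (bs.map List.headI).Pairwise (· > ·) ∧
    CKEquiv u bs.flatten ∧
    ∀ (σ p : List ℕ) (k : ℕ), CKEquiv u σ → p <+: σ → (∀ a ∈ p, k < a) →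
      p.length ≤ (bs.filter (fun b => k < b.headI)).flatten.length := by
  obtain ⟨bs, hbs, hheads, hck, hcount⟩ := _root_.exists_blocks _ h.good
  have hnn : ∀ c ∈ u.map (Nat.cast : ℕ → ℤ), 0 ≤ c := by simp
  have hnb : ∀ b ∈ bs, ∀ c ∈ b, 0 ≤ c := fun b hb c hc =>
    hnn c ((hck.mem_iff c).2 (List.mem_flatten.2 ⟨b, hb, hc⟩))
  have hhead0 : ∀ b ∈ bs, 0 ≤ b.headI := fun b hb => by
    cases b with
    | nil => rfl
    | cons a l => exact hnb _ hb a (by simp)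
  refine ⟨bs.map (List.map Int.toNat), ?_, ?_, ?_, ?_⟩
  · intro c hc
    obtain ⟨b, hb, rfl⟩ := List.mem_map.1 hc
    refine ⟨by simpa using (hbs b hb).1, ?_⟩
    rw [List.pairwise_map]
    refine (hbs b hb).2.imp_of_mem fun {x y} hx hy hxy => ?_
    have := hnb b hb x hx
    omega
  · simp only [List.map_map, List.pairwise_map, Function.comp_def, headI_map_toNat] at hheads ⊢
    refine hheads.imp_of_mem fun {x y} hx hy hxy => ?_
    have := hhead0 y hy
    omega
  · have := hck.ckEquiv_toNat hnn
    rwa [map_toNat_cast, List.map_flatten] at this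
  · intro σ p k hσ hp hk
    have h₁ := length_prefix_le_keyCount (k := k) h.good hσ.ckz (hp.map Nat.cast)
      (by simpa using hk) le_rfl
    rw [← hcount k _ le_rfl] at h₁
    have h₂ : (bs.map (List.map Int.toNat)).filter (fun b => k < b.headI) =
        (bs.filter (fun b => (k : ℤ) < b.headI)).map (List.map Int.toNat) := by
      rw [List.filter_map]
      congr 1
      refine List.filter_congr fun b _ => ?_
      simp only [Function.comp_def, headI_map_toNat, decide_eq_decide]
      omega
    rw [h₂, ← List.map_flatten, List.length_map]
    simpa using h₁


theorem List.Pairwise.filter_isPrefix {α : Type*} {p : α → Bool} {l : List α}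
    (h : l.Pairwise fun a b => p b → p a) : l.filter p <+: l := by
  induction l with
  | nil => simp
  | cons a l ih =>
    rw [List.pairwise_cons] at h
    by_cases ha : p a
    · simpa [List.filter_cons, ha] using ih h.2
    · have : l.filter p = [] := by
        rw [List.filter_eq_nil_iff]
        exact fun b hb hpb => ha (h.1 b hb hpb)
      simp [ha, this]

theorem List.Pairwise.headI_le {b : List ℕ} (h : b.Pairwise (· < ·)) {x : ℕ} (hx : x ∈ b) :
    b.headI ≤ x := by
  cases b with
  | nil => simp at hx
  | cons a l =>
    rcases List.mem_cons.1 hx with rfl | hx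
    · exact le_rfl
    · exact ((List.pairwise_cons.1 h).1 x hx).le

theorem runFact_flatten (u : List ℕ) : (runFact u).flatten = u := by
  induction u with
  | nil => simp [runFact]
  | cons a u ih =>
    rw [runFact]
    split
    · rename_i h
      rw [h] at ih
      simpa using ih
    · rename_i r rs h
      rw [h] at ih
      split_ifs <;> simpa using ih

theorem runFact_blocks (u : List ℕ) : ∀ b ∈ runFact u, b ≠ [] ∧ b.Pairwise (· < ·) := by
  induction u with
  | nil => simp [runFact]
  | cons a u ih =>
    rw [runFact]
    split
    · simp
    · rename_i r rs h
      rw [h] at ih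
      have hr := ih r (by simp)
      split_ifs with har
      · intro b hb
        rcases List.mem_cons.1 hb with rfl | hb
        · refine ⟨by simp, List.pairwise_cons.2 ⟨fun x hx => ?_, hr.2⟩⟩
          exact har.trans_le (hr.2.headI_le hx)
        · exact ih b (by simp [hb])
      · intro b hb
        rcases List.mem_cons.1 hb with rfl | hb
        · simp
        · exact ih b hb

theorem runFact_append {b w : List ℕ} (hb : b.Pairwise (· < ·)) (hne : b ≠ [])
    (hw : ∀ x ∈ b, ∀ r ∈ runFact w, r.headI ≤ x) : runFact (b ++ w) = b :: runFact w := by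
  induction b with
  | nil => exact absurd rfl hne
  | cons a b ih =>
    rw [List.pairwise_cons] at hb
    rw [List.cons_append, runFact]
    cases b with
    | nil =>
      rw [List.nil_append]
      cases h : runFact w with
      | nil => simp
      | cons r rs =>
        have := hw a (by simp) r (by simp [h])
        simp only
        rw [if_neg (by omega)]
    | cons a' b =>
      rw [ih hb.2 (by simp) fun x hx => hw x (List.mem_cons_of_mem _ hx)]
      have : a < a' := hb.1 a' (by simp)
      simp [this]

theorem runFact_flatten_eq {bs : List (List ℕ)} (hbs : ∀ b ∈ bs, b ≠ [] ∧ b.Pairwise (· < ·))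
    (hheads : (bs.map List.headI).Pairwise (· > ·)) : runFact bs.flatten = bs := by
  induction bs with
  | nil => simp [runFact]
  | cons b bs ih =>
    rw [List.map_cons, List.pairwise_cons] at hheads
    have hb := hbs b (by simp)
    have ih := ih (fun c hc => hbs c (List.mem_cons_of_mem _ hc)) hheads.2
    rw [List.flatten_cons, runFact_append hb.2 hb.1, ih]
    rw [ih]
    intro x hx r hr
    exact (hheads.1 _ (List.mem_map_of_mem hr)).le.trans (hb.2.headI_le hx)

theorem wdtRowsAux_spec (p : ℤ) (bs : List (List ℕ)) : (wdtRowsAux p bs).length = bs.length ∧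
    (∀ r ∈ wdtRowsAux p bs, r < p) ∧ (wdtRowsAux p bs).Pairwise (· > ·) ∧
    ∀ q ∈ (wdtRowsAux p bs).zip bs, q.1 ≤ (q.2.headI : ℤ) := by
  induction bs generalizing p with
  | nil => simp [wdtRowsAux]
  | cons b bs ih =>
    rw [wdtRowsAux]
    set m := min (p - 1) (b.headI : ℤ) with hm
    have hmp : m < p := by omega
    obtain ⟨h₁, h₂, h₃, h₄⟩ := ih m
    refine ⟨by simp [h₁], ?_, List.pairwise_cons.2 ⟨h₂, h₃⟩, ?_⟩
    · intro r hr
      rcases List.mem_cons.1 hr with rfl | hr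
      · exact hmp
      · exact (h₂ r hr).trans hmp
    · intro q hq
      rw [List.zip_cons_cons] at hq
      rcases List.mem_cons.1 hq with rfl | hq
      · exact min_le_right _ _
      · exact h₄ q hq

theorem wdtRows_spec (bs : List (List ℕ)) : (wdtRows bs).length = bs.length ∧
    (wdtRows bs).Pairwise (· > ·) ∧ ∀ q ∈ (wdtRows bs).zip bs, q.1 ≤ (q.2.headI : ℤ) := by
  cases bs with
  | nil => simp [wdtRows]
  | cons b bs =>
    obtain ⟨h₁, h₂, h₃, h₄⟩ := wdtRowsAux_spec b.headI bs
    rw [wdtRows]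
    refine ⟨by simp [h₁], List.pairwise_cons.2 ⟨h₂, h₃⟩, ?_⟩
    intro q hq
    rw [List.zip_cons_cons] at hq
    rcases List.mem_cons.1 hq with rfl | hq
    · exact le_rfl
    · exact h₄ q hq

theorem wdtRowsAux_eq {p : ℤ} {bs : List (List ℕ)} (hp : ∀ b ∈ bs, (b.headI : ℤ) < p)
    (hheads : (bs.map List.headI).Pairwise (· > ·)) :
    wdtRowsAux p bs = bs.map fun b => (b.headI : ℤ) := by
  induction bs generalizing p with
  | nil => simp [wdtRowsAux]
  | cons b bs ih =>
    rw [List.map_cons, List.pairwise_cons] at hheads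
    have hb : min (p - 1) (b.headI : ℤ) = b.headI :=
      min_eq_right (by have := hp b (by simp); omega)
    rw [wdtRowsAux, hb, ih (fun c hc => ?_) hheads.2, List.map_cons]
    exact_mod_cast hheads.1 _ (List.mem_map_of_mem hc)

theorem wdtRows_eq {bs : List (List ℕ)} (hheads : (bs.map List.headI).Pairwise (· > ·)) :
    wdtRows bs = bs.map fun b => (b.headI : ℤ) := by
  cases bs with
  | nil => simp [wdtRows]
  | cons b bs =>
    rw [List.map_cons, List.pairwise_cons] at hheads
    rw [wdtRows, wdtRowsAux_eq (fun c hc => ?_) hheads.2, List.map_cons]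
    exact_mod_cast hheads.1 _ (List.mem_map_of_mem hc)

/-- The blocks of the run factorization paired with the rows they occupy. -/
def rowBlocks (u : List ℕ) : List (ℤ × List ℕ) := (wdtRows (runFact u)).zip (runFact u)

/-- The number of boxes of a list of labelled blocks in the rows satisfying a condition. -/
def boxCount (L : List (ℤ × List ℕ)) (P : ℤ → Bool) : ℕ :=
  ((L.filter fun q => P q.1).map Prod.snd).flatten.length

theorem boxCount_cons (q : ℤ × List ℕ) (L : List (ℤ × List ℕ)) (P : ℤ → Bool) :
    boxCount (q :: L) P = (if P q.1 then q.2.length else 0) + boxCount L P := by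
  unfold boxCount
  by_cases h : P q.1 <;> simp [h]

theorem rowBlocks_map_snd (u : List ℕ) : (rowBlocks u).map Prod.snd = runFact u :=
  List.map_snd_zip (wdtRows_spec _).1.ge

theorem rowBlocks_map_fst (u : List ℕ) : (rowBlocks u).map Prod.fst = wdtRows (runFact u) :=
  List.map_fst_zip (wdtRows_spec _).1.le

theorem rowBlocks_pairwise (u : List ℕ) : (rowBlocks u).Pairwise fun p q => q.1 < p.1 := by
  have := (wdtRows_spec (runFact u)).2.1
  rwa [← rowBlocks_map_fst, List.pairwise_map] at this

theorem snd_mem_runFact {u : List ℕ} {q : ℤ × List ℕ} (hq : q ∈ rowBlocks u) :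
    q.2 ∈ runFact u := by
  rw [← rowBlocks_map_snd]
  exact List.mem_map_of_mem hq

theorem boxCount_true (u : List ℕ) : boxCount (rowBlocks u) (fun _ => true) = u.length := by
  simp [boxCount, rowBlocks_map_snd, runFact_flatten]

theorem find_getD_ne_zero_iff {L : List (ℤ × List ℕ)} (hL : L.Pairwise fun p q => q.1 < p.1)
    (h0 : ∀ q ∈ L, ∀ x ∈ q.2, x ≠ 0) (r : ℤ) (c : ℕ) :
    (match L.find? (fun p => decide (p.1 = r)) with
      | some p => p.2.getD c 0
      | none => 0) ≠ 0 ↔ c < boxCount L (fun s => decide (s = r)) := by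
  induction L with
  | nil => simp [boxCount]
  | cons q L ih =>
    rw [List.pairwise_cons] at hL
    rw [boxCount_cons, List.find?_cons]
    by_cases hq : q.1 = r
    · have hz : boxCount L (fun s => decide (s = r)) = 0 := by
        have : L.filter (fun q => decide (q.1 = r)) = [] := by
          rw [List.filter_eq_nil_iff]
          intro p hp
          have := hL.1 p hp
          simp only [decide_eq_true_eq]
          omega
        simp [boxCount, this]
      simp only [hq, decide_true, hz, if_true, add_zero]
      by_cases hc : c < q.2.length
      · simp only [hc, iff_true, List.getD_eq_getElem _ _ hc]
        exact h0 q (by simp) _ (List.getElem_mem hc)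
      · simp only [hc, iff_false, not_not]
        exact List.getD_eq_default _ _ (by omega)
    · simp only [hq, decide_false, Bool.false_eq_true, if_false, zero_add]
      exact ih hL.2 fun p hp => h0 p (List.mem_cons_of_mem _ hp)

theorem weakDesTab_ne_zero_iff {u : List ℕ} (hu : PosWord u) (r : ℤ) (c : ℕ) :
    weakDesTab u r c ≠ 0 ↔
      1 ≤ c ∧ c ≤ boxCount (rowBlocks u) (fun s => decide (s = r)) := by
  rw [weakDesTab]
  by_cases hc : c = 0
  · simp [hc]
  · rw [if_neg hc]
    have := find_getD_ne_zero_iff (rowBlocks_pairwise u) (fun q hq x hx => ?_) r (c - 1)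
    · rw [show (1 ≤ c ∧ c ≤ boxCount (rowBlocks u) (fun s => decide (s = r))) ↔
        c - 1 < boxCount (rowBlocks u) (fun s => decide (s = r)) by omega, ← this, rowBlocks]
    · refine Nat.one_le_iff_ne_zero.1 (hu x ?_)
      rw [← runFact_flatten u]
      exact List.mem_flatten.2 ⟨_, snd_mem_runFact hq, hx⟩

theorem desComp_eq {u : List ℕ} (hu : PosWord u) (i : ℕ) :
    desComp u i = boxCount (rowBlocks u) (fun s => decide (s = (i : ℤ))) := by
  have : {c : ℕ | weakDesTab u i c ≠ 0} =
      ↑(Finset.Icc 1 (boxCount (rowBlocks u) (fun s => decide (s = (i : ℤ))))) := by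
    ext c
    simp [weakDesTab_ne_zero_iff hu]
  rw [desComp, shapeOf, this, Set.ncard_coe_finset, Nat.card_Icc, Nat.add_sub_cancel]

theorem sum_boxCount {L : List (ℤ × List ℕ)} (hL : ∀ q ∈ L, 1 ≤ q.1) (k : ℕ) :
    ∑ i ∈ Finset.Icc 1 k, boxCount L (fun s => decide (s = (i : ℤ))) +
      boxCount L (fun s => decide ((k : ℤ) < s)) = boxCount L (fun _ => true) := by
  induction L with
  | nil => simp [boxCount]
  | cons q L ih =>
    have ih := ih fun p hp => hL p (List.mem_cons_of_mem _ hp)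
    have hq := hL q (by simp)
    obtain ⟨n, hn⟩ := Int.eq_ofNat_of_zero_le (by omega : 0 ≤ q.1)
    simp only [boxCount_cons, Finset.sum_add_distrib, if_true, hn, decide_eq_true_eq,
      Nat.cast_inj, Nat.cast_lt, Finset.sum_ite_eq, Finset.mem_Icc]
    split_ifs <;> omega

theorem sum_desComp {u : List ℕ} (hu : PosWord u) (hv : NonVirtual u) (k : ℕ) :
    ∑ i ∈ Finset.Icc 1 k, desComp u i +
      boxCount (rowBlocks u) (fun s => decide ((k : ℤ) < s)) = u.length := by
  simp only [desComp_eq hu]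
  rw [sum_boxCount, boxCount_true]
  intro q hq
  refine hv _ ?_
  rw [← rowBlocks_map_fst]
  exact List.mem_map_of_mem hq

theorem exists_prefix_boxCount (u : List ℕ) (k : ℕ) : ∃ p, p <+: u ∧ (∀ a ∈ p, k < a) ∧
    p.length = boxCount (rowBlocks u) (fun s => decide ((k : ℤ) < s)) := by
  refine ⟨_, ?_, ?_, rfl⟩
  · conv_rhs => rw [← runFact_flatten u, ← rowBlocks_map_snd]
    refine List.IsPrefix.flatten (List.IsPrefix.map _ (List.Pairwise.filter_isPrefix ?_))
    refine (rowBlocks_pairwise u).imp fun {p q} h => ?_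
    simp only [decide_eq_true_eq]
    omega
  · intro a ha
    obtain ⟨b, hb, hab⟩ := List.mem_flatten.1 ha
    obtain ⟨q, hq, rfl⟩ := List.mem_map.1 hb
    rw [List.mem_filter, decide_eq_true_eq] at hq
    have h₁ := (wdtRows_spec (runFact u)).2.2 q hq.1
    have h₂ := (runFact_blocks u _ (snd_mem_runFact hq.1)).2.headI_le hab
    omega

theorem rowBlocks_flatten {bs : List (List ℕ)} (hbs : ∀ b ∈ bs, b ≠ [] ∧ b.Pairwise (· < ·))
    (hheads : (bs.map List.headI).Pairwise (· > ·)) :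
    rowBlocks bs.flatten = bs.map fun b => ((b.headI : ℤ), b) := by
  rw [rowBlocks, runFact_flatten_eq hbs hheads, wdtRows_eq hheads]
  clear hbs hheads
  induction bs with
  | nil => rfl
  | cons b bs ih => simp [ih]

theorem headI_mem {b : List ℕ} (h : b ≠ []) : b.headI ∈ b := by
  cases b with
  | nil => exact absurd rfl h
  | cons a l => simp

theorem length_flatten_filter_lt {α : Type*} {bs : List (List α)} {p : List α → Bool}
    {b : List α} (hb : b ∈ bs) (hp : p b = false) (hne : b ≠ []) :
    (bs.filter p).flatten.length < bs.flatten.length := by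
  obtain ⟨s, t, rfl⟩ := List.append_of_mem hb
  have hs := (List.filter_sublist (p := p) (l := s)).flatten.length_le
  have ht := (List.filter_sublist (p := p) (l := t)).flatten.length_le
  have := List.length_pos_iff.2 hne
  rw [List.filter_append, List.filter_cons_of_neg (by simp [hp])]
  simp only [List.flatten_append, List.flatten_cons, List.length_append]
  omega

/-- A Yamanouchi word occupies no row below the smallest letter of its class, and it does
occupy that row. -/
theorem IsReducedWord.hatP_spec {u : List ℕ} (h : IsReducedWord u) :
    (∀ (r : ℤ) (c : ℕ), hatP u r c ≠ 0 → 1 ≤ r ∧ ∃ m ∈ u, (m : ℤ) ≤ r) ∧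
    ∀ m ∈ u, (∀ a ∈ u, m ≤ a) → ∃ c, hatP u m c ≠ 0 := by
  obtain ⟨bs, hbs, hheads, hck, hbound⟩ := h.exists_blocks
  set y := bs.flatten with hy
  have hyr := hck.isReducedWord h
  have hrow := rowBlocks_flatten hbs hheads
  have hmem : ∀ b ∈ bs, ∀ x ∈ b, x ∈ u := fun b hb x hx =>
    (hck.mem_iff x).2 (List.mem_flatten.2 ⟨b, hb, hx⟩)
  have hynv : NonVirtual y := by
    rw [NonVirtual, hy, runFact_flatten_eq hbs hheads, wdtRows_eq hheads]
    intro r hr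
    obtain ⟨b, hb, rfl⟩ := List.mem_map.1 hr
    exact_mod_cast h.1 _ (hmem b hb _ (headI_mem (hbs b hb).1))
  have hycount : ∀ k : ℕ, boxCount (rowBlocks y) (fun s => decide ((k : ℤ) < s)) =
      (bs.filter (fun b => k < b.headI)).flatten.length := fun k => by
    rw [hrow, boxCount, List.filter_map, List.map_map]
    simp [Function.comp_def]
  have hle : ∀ σ, NonVirtual σ → CKEquiv u σ → compLE (desComp y) (desComp σ) := by
    intro σ hσ huσ k
    have h₁ := sum_desComp (huσ.posWord h.1) hσ k
    have h₂ := sum_desComp hyr.1 hynv k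
    obtain ⟨p, hp, hpk, hlen⟩ := exists_prefix_boxCount σ k
    have h₃ := hbound σ p k huσ hp hpk
    rw [hycount] at h₂
    have := huσ.length_eq
    have := hck.length_eq
    omega
  have hex : ∃ σ, Yamanouchi σ ∧ CKEquiv u σ :=
    ⟨y, ⟨hyr, hynv, fun σ hσ hyσ => hle σ hσ (hck.trans hyσ)⟩, hck⟩
  have hhat : hatRho u = hex.choose := by
    rw [hatRho, dif_pos hex]
  obtain ⟨⟨hσr, hσnv, hσmin⟩, huσ⟩ := hex.choose_spec
  simp only [hatP, hhat]
  generalize hex.choose = σ at *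
  have hcount : ∀ k : ℕ, boxCount (rowBlocks σ) (fun s => decide ((k : ℤ) < s)) =
      (bs.filter (fun b => k < b.headI)).flatten.length := fun k => by
    have h₁ := sum_desComp hσr.1 hσnv k
    have h₂ := sum_desComp hyr.1 hynv k
    have h₃ := hle σ hσnv huσ k
    have h₄ := hσmin y hynv (huσ.symm.trans hck) k
    rw [hycount] at h₂
    have := huσ.length_eq
    have := hck.length_eq
    omega
  have huy := hck.length_eq
  have huσl := huσ.length_eq
  have hfull : ∀ k : ℕ, (∀ a ∈ u, k < a) → ∑ i ∈ Finset.Icc 1 k, desComp σ i = 0 := fun k hk => by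
    have h₁ := sum_desComp hσr.1 hσnv k
    have h₂ : bs.filter (fun b => k < b.headI) = bs := List.filter_eq_self.2 fun b hb => by
      simpa using hk _ (hmem b hb _ (headI_mem (hbs b hb).1))
    rw [hcount, h₂, ← hy] at h₁
    omega
  refine ⟨fun r c hrc => ?_, fun m hm hmin => ?_⟩
  · rw [weakDesTab_ne_zero_iff hσr.1] at hrc
    have hr : 1 ≤ r := by
      by_contra hr
      have : (rowBlocks σ).filter (fun q => decide (q.1 = r)) = [] := by
        rw [List.filter_eq_nil_iff]
        intro q hq
        have := hσnv q.1 (by rw [← rowBlocks_map_fst]; exact List.mem_map_of_mem hq)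
        simp only [decide_eq_true_eq]
        omega
      simp only [boxCount, this, List.map_nil, List.flatten_nil, List.length_nil] at hrc
      omega
    refine ⟨hr, ?_⟩
    obtain ⟨n, rfl⟩ := Int.eq_ofNat_of_zero_le (by omega : 0 ≤ r)
    by_contra! hc
    have h₁ := Finset.sum_eq_zero_iff.1 (hfull n fun a ha => by exact_mod_cast hc a ha) n
      (by rw [Finset.mem_Icc]; omega)
    rw [desComp_eq hσr.1] at h₁
    omega
  · have hm1 := h.1 m hm
    obtain ⟨k, rfl⟩ : ∃ k, m = k + 1 := ⟨m - 1, by omega⟩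
    have h₁ := hfull k fun a ha => hmin a ha
    have h₂ := sum_desComp hσr.1 hσnv (k + 1)
    obtain ⟨b, hb, hmb⟩ := List.mem_flatten.1 ((hck.mem_iff _).1 hm)
    have h₃ : b.headI ≤ k + 1 := (hbs b hb).2.headI_le hmb
    have h₄ := length_flatten_filter_lt (p := fun b => decide (k + 1 < b.headI)) hb
      (by simpa using h₃) (hbs b hb).1
    rw [Finset.sum_Icc_succ_top (by omega), h₁, hcount, desComp_eq hσr.1] at h₂
    refine ⟨1, (weakDesTab_ne_zero_iff hσr.1 _ _).2 ⟨le_rfl, ?_⟩⟩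
    rw [← hy] at h₄
    omega

theorem hatP_nil (r : ℤ) (c : ℕ) : hatP [] r c = 0 := by
  have h : IsReducedWord [] := ⟨by simp [PosWord], by simp⟩
  by_contra hc
  obtain ⟨_, m, hm, _⟩ := h.hatP_spec.1 r c hc
  simp at hm

theorem foldr_append_eq_flatten {α : Type*} (L : List (List α)) :
    L.foldr (· ++ ·) [] = L.flatten := by
  induction L with
  | nil => rfl
  | cons a L ih => simp [ih]

section Factorization

variable {f : ℕ → List ℕ}

theorem factWordGe_eq (f : ℕ → List ℕ) (i : ℕ) : factWordGe f i =
    ((((List.range (topIdx f + 1)).reverse).filter (fun j => decide (i ≤ j))).map f).flatten := by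
  rw [factWordGe, foldr_append_eq_flatten]

theorem le_topIdx (hfin : {i : ℕ | f i ≠ []}.Finite) {j : ℕ} (h : f j ≠ []) : j ≤ topIdx f :=
  le_csSup hfin.bddAbove h

theorem mem_factWordGe (hfin : {i : ℕ | f i ≠ []}.Finite) {i x : ℕ} :
    x ∈ factWordGe f i ↔ ∃ j, i ≤ j ∧ x ∈ f j := by
  rw [factWordGe_eq]
  simp only [List.mem_flatten, List.mem_map, List.mem_filter, List.mem_reverse, List.mem_range,
    decide_eq_true_eq]
  constructor
  · rintro ⟨l, ⟨j, ⟨_, hj⟩, rfl⟩, hx⟩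
    exact ⟨j, hj, hx⟩
  · rintro ⟨j, hj, hx⟩
    have := le_topIdx hfin (List.ne_nil_of_mem hx)
    exact ⟨_, ⟨j, ⟨by omega, hj⟩, rfl⟩, hx⟩

theorem factWordGe_isPrefix (f : ℕ → List ℕ) (i : ℕ) : factWordGe f i <+: factWord f := by
  rw [factWord, factWordGe_eq, factWordGe_eq]
  refine List.IsPrefix.flatten (List.IsPrefix.map _ ?_)
  simp only [Nat.zero_le, decide_true, List.filter_true]
  refine List.Pairwise.filter_isPrefix ?_
  rw [List.pairwise_reverse]
  refine List.pairwise_lt_range.imp fun {a b} h => ?_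
  simp only [decide_eq_true_eq]
  omega

theorem IsReducedWord.factWordGe (h : IsReducedWord (factWord f)) (i : ℕ) :
    IsReducedWord (factWordGe f i) := by
  obtain ⟨t, ht⟩ := factWordGe_isPrefix f i
  rw [← ht] at h
  exact IsReducedWord.factor (a := []) (b := t) h

theorem factWordGe_eq_nil {j : ℕ} (h : topIdx f < j) : factWordGe f j = [] := by
  have : ((List.range (topIdx f + 1)).reverse).filter (fun i => decide (j ≤ i)) = [] := by
    rw [List.filter_eq_nil_iff]
    intro a ha
    simp only [List.mem_reverse, List.mem_range] at ha
    simp only [decide_eq_true_eq]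
    omega
  rw [factWordGe_eq, this]
  rfl

/-- The entries that may be recorded in a box are at most the number of blocks. -/
theorem hatQfact_bddAbove (f : ℕ → List ℕ) (r : ℤ) (c : ℕ) :
    BddAbove {i : ℕ | 1 ≤ i ∧ hatP (factWordGe f i) r c ≠ 0 ∧
      hatP (factWordGe f (i + 1)) r c = 0} := by
  refine ⟨topIdx f, fun i hi => ?_⟩
  by_contra! h
  exact hi.2.1 (by rw [factWordGe_eq_nil h, hatP_nil])

theorem le_hatQfact {i : ℕ} {r : ℤ} {c : ℕ} (hi : 1 ≤ i) (h : hatP (factWordGe f i) r c ≠ 0) :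
    i ≤ hatQfact f r c := by
  obtain ⟨n, hn⟩ : ∃ n, topIdx f + 1 = i + n ∨ topIdx f + 1 < i :=
    ⟨topIdx f + 1 - i, by omega⟩
  rcases hn with hn | hn
  · induction n generalizing i with
    | zero => exact absurd (by rw [factWordGe_eq_nil (by omega), hatP_nil]) h
    | succ n ih =>
      by_cases h' : hatP (factWordGe f (i + 1)) r c = 0
      · exact le_csSup (hatQfact_bddAbove f r c) ⟨hi, h, h'⟩
      · exact (Nat.le_succ i).trans (ih (by omega) h' (by omega))
  · exact absurd (by rw [factWordGe_eq_nil (by omega), hatP_nil]) h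

theorem hatP_hatQfact {r : ℤ} {c : ℕ} (h : hatQfact f r c ≠ 0) :
    hatP (factWordGe f (hatQfact f r c)) r c ≠ 0 := by
  have hne : {i : ℕ | 1 ≤ i ∧ hatP (factWordGe f i) r c ≠ 0 ∧
      hatP (factWordGe f (i + 1)) r c = 0}.Nonempty := by
    by_contra hne
    rw [Set.not_nonempty_iff_eq_empty] at hne
    exact h (by rw [hatQfact, hne, csSup_empty]; rfl)
  exact (Nat.sSup_mem hne (hatQfact_bddAbove f r c)).2.1

end Factorization

/-- Lemma `flag lemma`.
Let `φ` be a flag and `ρ^•` an increasing factorization of a reduced word.  The weak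
Edelman–Greene recording tableau `Q̂(ρ^•)` is `φ`-flagged (every entry in its `i`-th row is
at most `φ(i)`) if and only if `ρ^•` is `φ`-flagged (every nonempty block `ρ^{(i)}` has
first letter `ρ^{(i)}_1` with `φ(ρ^{(i)}_1) ≥ i`). -/
theorem hatQ_flagged_iff (φ : ℕ → ℕ) (hφ : IsFlag φ) (f : ℕ → List ℕ) (hf0 : f 0 = [])
    (hfin : {i : ℕ | f i ≠ []}.Finite) (hinc : IncreasingFact f)
    (hred : IsReducedWord (factWord f)) :
    FlaggedTab φ (hatQfact f) ↔ FlaggedFact φ f := by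
  constructor
  · intro hQ i hi
    have hi1 : 1 ≤ i := by
      by_contra h
      obtain rfl : i = 0 := by omega
      exact hi hf0
    have hhead : (f i).headI ∈ factWordGe f i :=
      (mem_factWordGe hfin).2 ⟨i, le_rfl, headI_mem hi⟩
    have hex : ∃ m, m ∈ factWordGe f i := ⟨_, hhead⟩
    classical
    have hmin : ∀ a ∈ factWordGe f i, Nat.find hex ≤ a := fun a ha => Nat.find_min' hex ha
    obtain ⟨c, hc⟩ := (hred.factWordGe i).hatP_spec.2 _ (Nat.find_spec hex) hmin
    have hm1 : 1 ≤ Nat.find hex := (hred.factWordGe i).1 _ (Nat.find_spec hex)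
    exact ((le_hatQfact hi1 hc).trans (hQ _ c)).trans (hφ.1 _ _ hm1 (hmin _ hhead))
  · intro hf r c
    by_cases h0 : hatQfact f r c = 0
    · rw [h0]
      exact Nat.zero_le _
    · obtain ⟨_, m, hm, hmr⟩ := (hred.factWordGe _).hatP_spec.1 _ _ (hatP_hatQfact h0)
      obtain ⟨j, hj, hmj⟩ := (mem_factWordGe hfin).1 hm
      have hne := List.ne_nil_of_mem hmj
      have hhead : (f j).headI ≤ m := (List.isChain_iff_pairwise.1 (hinc j)).headI_le hmj
      have hpos : 1 ≤ (f j).headI :=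
        hred.1 _ ((mem_factWordGe hfin).2 ⟨j, Nat.zero_le _, headI_mem hne⟩)
      exact (hj.trans (hf j hne)).trans (hφ.1 _ _ hpos (hhead.trans (by exact_mod_cast hmr)))
end

section
/- Let w ∈ S∞, n a positive integer, and φ a flag. If r^• ∈ RF_n(w) is φ-flagged, then for every 1 ≤ i < n the Morse–Schilling raising operator satisfies: e_i(r^•) is φ-flagged or e_i(r^•) = 0. -/
noncomputable section
attribute [local instance] Classical.propDecidable

theorem mem_factWord {f : ℕ → List ℕ} {n : ℕ} (hn : ∀ j, n < j → f j = []) {j x : ℕ}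
    (hx : x ∈ f j) : x ∈ factWord f := by
  have hbdd : BddAbove {i : ℕ | f i ≠ []} :=
    ⟨n, fun i hi => not_lt.mp fun h => hi (hn i h)⟩
  have hj : j ≤ topIdx f := le_csSup hbdd (List.ne_nil_of_mem hx)
  have hflat (l : List (List ℕ)) : l.foldr (· ++ ·) [] = l.flatten := by
    induction l with
    | nil => rfl
    | cons a l ih => simp [ih]
  unfold factWord factWordGe
  rw [hflat, List.mem_flatten]
  refine ⟨f j, List.mem_map.mpr ⟨j, ?_, rfl⟩, hx⟩
  simp
  omega

theorem unpairedUpper_subset (B A : List ℕ) : unpairedUpper B A ⊆ A := by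
  induction B generalizing A with
  | nil => exact List.Subset.refl A
  | cons b B ih =>
    unfold unpairedUpper
    split
    · exact fun x hx => List.mem_of_mem_erase (ih _ hx)
    · exact ih A

theorem eq_or_mem_of_mem_insAsc {x y : ℕ} {l : List ℕ} (h : y ∈ insAsc x l) :
    y = x ∨ y ∈ l := by
  induction l with
  | nil => simpa [insAsc] using h
  | cons z l ih =>
    unfold insAsc at h
    split at h <;> grind

theorem foldr_max_mem {l : List ℕ} (hl : l ≠ []) : l.foldr max 0 ∈ l := by
  induction l with
  | nil => exact absurd rfl hl
  | cons a l ih =>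
    rcases eq_or_ne l [] with rfl | h
    · simp
    · have := ih h
      rw [List.foldr_cons]
      rcases max_choice a (l.foldr max 0) with h' | h' <;> rw [h'] <;> simp [this]

theorem headI_mem_s14 {l : List ℕ} (hl : l ≠ []) : l.headI ∈ l := by
  cases l with
  | nil => exact absurd rfl hl
  | cons a l => simp

theorem headI_le_of_mem {l : List ℕ} (hl : l.IsChain (· < ·)) {x : ℕ} (hx : x ∈ l) :
    l.headI ≤ x := by
  cases l with
  | nil => simp at hx
  | cons a l =>
    rcases List.mem_cons.mp hx with rfl | hx
    · exact le_rfl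
    · exact (List.rel_of_pairwise_cons hl.pairwise hx).le

/-- In a flagged increasing factorization into positive letters, the flag condition holds for
every letter, not only for the first letter of each block. -/
theorem FlaggedFact.le_of_mem {φ : ℕ → ℕ} {f : ℕ → List ℕ} (hflag : FlaggedFact φ f)
    (hφ : IsFlag φ) (hinc : IncreasingFact f) (hpos : ∀ j, ∀ x ∈ f j, 1 ≤ x)
    {j x : ℕ} (hx : x ∈ f j) : j ≤ φ x :=
  have hne := List.ne_nil_of_mem hx
  (hflag j hne).trans
    (hφ.1 _ _ (hpos j _ (headI_mem_s14 hne)) (headI_le_of_mem (hinc j) hx))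

/-- Lemma `crystal and flag`.
If `r^• ∈ RF_n(w)` is `φ`-flagged, then for every `1 ≤ i < n` the Morse–Schilling raising
operator satisfies: `e_i(r^•)` is `φ`-flagged or `e_i(r^•) = 0`. -/
theorem msE_preserves_flag (w : Equiv.Perm ℕ) (hw : FinitaryPerm w) (n : ℕ) (hn : 1 ≤ n)
    (φ : ℕ → ℕ) (hφ : IsFlag φ) (f : ℕ → List ℕ) (hf : f ∈ RFn n w)
    (hflag : FlaggedFact φ f) (i : ℕ) (hi1 : 1 ≤ i) (hin : i < n) :
    msE i f = none ∨ ∃ g, msE i f = some g ∧ FlaggedFact φ g := by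
  obtain ⟨-, hbdd, hinc, hred, -⟩ := hf
  have hpos (j x : ℕ) (hx : x ∈ f j) : 1 ≤ x := hred.1 x (mem_factWord hbdd hx)
  have hle {j x : ℕ} (hx : x ∈ f j) : j ≤ φ x := hflag.le_of_mem hφ hinc hpos hx
  by_cases hL : unpairedUpper (f i).reverse (f (i + 1)) = []
  · exact Or.inl (by simp [msE, hL])
  refine Or.inr ⟨_, if_neg hL, fun j hj => ?_⟩
  have ha := unpairedUpper_subset _ _ (foldr_max_mem hL)
  have hx := headI_mem_s14 hj
  generalize List.headI (α := ℕ) _ = x at hx ⊢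
  rcases eq_or_ne j i with rfl | hji
  · rw [Function.update_self] at hx
    rcases eq_or_mem_of_mem_insAsc hx with rfl | hx
    · exact (Nat.le_succ j).trans
        ((hle ha).trans (hφ.1 _ _ (hpos _ _ ha) (Nat.le_add_right _ _)))
    · exact hle hx
  · rw [Function.update_of_ne hji] at hx
    rcases eq_or_ne j (i + 1) with rfl | hji'
    · rw [Function.update_self] at hx
      exact hle (List.mem_of_mem_erase hx)
    · rw [Function.update_of_ne hji'] at hx
      exact hle hx

end
end

section
/- Let α be a weak composition, φ a flag, and T ∈ SSKT(α,φ). For every positive integer i, the Assaf–Schilling raising operator satisfies e_i(T) ∈ SSKT(α,φ) or e_i(T) = 0. -/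
noncomputable section
attribute [local instance] Classical.propDecidable

/-- The boxes with entry `v` weakly after the position `(r, c)` in the reverse column reading
order. -/
def boxesUpTo (T : Tableau) (v : ℕ) (r : ℤ) (c : ℕ) : Set (ℤ × ℕ) :=
  {p : ℤ × ℕ | T p.1 p.2 = v ∧ (p.2 < c ∨ (p.2 = c ∧ p.1 ≤ r))}

lemma finite_boxesUpTo {T : Tableau} (hT : {p : ℤ × ℕ | T p.1 p.2 ≠ 0}.Finite) {v : ℕ}
    (hv : 1 ≤ v) (r : ℤ) (c : ℕ) : (boxesUpTo T v r c).Finite :=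
  hT.subset fun p hp => by
    have := hp.1
    simp only [Set.mem_ofPred_eq]
    omega

lemma mi_eq_ncard_sub (T : Tableau) (i : ℕ) (r : ℤ) (c : ℕ) :
    mi T i r c = ((boxesUpTo T (i + 1) r c).ncard : ℤ) - ((boxesUpTo T i r c).ncard : ℤ) := rfl

/-- The statistic `mi` at an arbitrary position is `0` or is attained at a box weakly after
that position. -/
lemma mi_eq_zero_or_exists_box {T : Tableau} (hT : {p : ℤ × ℕ | T p.1 p.2 ≠ 0}.Finite) {i : ℕ}
    (hi : 1 ≤ i) (r : ℤ) (c : ℕ) :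
    mi T i r c = 0 ∨ ∃ r' c', T r' c' ≠ 0 ∧ (c' < c ∨ (c' = c ∧ r' ≤ r)) ∧
      mi T i r' c' = mi T i r c := by
  set S : Set (ℤ × ℕ) := {p | T p.1 p.2 ≠ 0 ∧ (p.2 < c ∨ (p.2 = c ∧ p.1 ≤ r))} with hS
  have hSf : S.Finite := hT.subset fun p hp => hp.1
  rcases S.eq_empty_or_nonempty with h | h
  · left
    have key : ∀ v, 1 ≤ v → boxesUpTo T v r c = ∅ := by
      intro v hv
      refine Set.eq_empty_of_forall_notMem fun p hp => ?_
      have : p ∈ S := ⟨by have := hp.1; omega, hp.2⟩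
      simp [h] at this
    simp [mi_eq_ncard_sub, key i hi, key (i + 1) (by omega)]
  · right
    obtain ⟨⟨r', c'⟩, hp, hmax⟩ :=
      Set.exists_max_image S (fun p => toLex (p.2, p.1)) hSf h
    refine ⟨r', c', hp.1, hp.2, ?_⟩
    have key : ∀ v, 1 ≤ v → boxesUpTo T v r' c' = boxesUpTo T v r c := by
      intro v hv
      ext ⟨a, b⟩
      have h2 := hp.2
      constructor
      · rintro ⟨h1, h3⟩
        refine ⟨h1, ?_⟩
        simp only at h2 h3 ⊢
        omega
      · rintro ⟨h1, h3⟩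
        have := hmax (a, b) ⟨by simp only at h1 ⊢; omega, h3⟩
        simp only [Prod.Lex.le_iff, ofLex_toLex] at this
        exact ⟨h1, this⟩
    rw [mi_eq_ncard_sub, mi_eq_ncard_sub, key i hi, key (i + 1) (by omega)]

/-- Swap `i` and `i + 1` in all columns weakly right of `c₀` in which row `r₀` has entry
`i + 1`. -/
def swapCols (T : Tableau) (i : ℕ) (r₀ : ℤ) (c₀ : ℕ) : Tableau := fun r c =>
  if c₀ ≤ c ∧ T r₀ c = i + 1 then
    (if T r c = i + 1 then i else if T r c = i then i + 1 else T r c)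
  else T r c

lemma swapCols_ne_zero_iff {T : Tableau} {i : ℕ} (hi : 1 ≤ i) (r₀ : ℤ) (c₀ : ℕ) (r : ℤ) (c : ℕ) :
    swapCols T i r₀ c₀ r c ≠ 0 ↔ T r c ≠ 0 := by
  unfold swapCols
  split_ifs <;> omega

lemma shapeOf_swapCols {T : Tableau} {i : ℕ} (hi : 1 ≤ i) (r₀ : ℤ) (c₀ : ℕ) :
    shapeOf (swapCols T i r₀ c₀) = shapeOf T := by
  funext j
  simp only [shapeOf, swapCols_ne_zero_iff hi]

lemma IsKeyTableau.row_antitone {T : Tableau} (hT : IsKeyTableau T) {r : ℤ} {c d : ℕ}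
    (hc : 1 ≤ c) (hcd : c ≤ d) (hd : T r d ≠ 0) : T r d ≤ T r c := by
  obtain ⟨-, -, -, hleft, hrow, -, -⟩ := hT
  induction d, hcd using Nat.le_induction with
  | base => exact le_rfl
  | succ d hd' ih =>
    exact (hrow r d (by omega) hd).trans (ih (hleft r d (by omega) hd))

/-- If a row below `r₀` has no entry `i` in column `c₀`, then it has none in the columns where
the run of `i + 1` of row `r₀` continues. -/
lemma IsKeyTableau.ne_of_lt_row {T : Tableau} (hT : IsKeyTableau T) {i : ℕ} (hi : 1 ≤ i)
    {r₀ : ℤ} {c₀ : ℕ} (hq : T r₀ c₀ = i + 1) (hbelow : ∀ r < r₀, T r c₀ ≠ i)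
    {r : ℤ} {c : ℕ} (hr : r < r₀) (hc : c₀ ≤ c) (hrc : T r₀ c = i + 1) : T r c ≠ i := by
  intro h
  have hT' := hT
  obtain ⟨-, hzero, -, hleft, hrow, hcol, hkey⟩ := hT'
  have hc₀ : 1 ≤ c₀ := by
    by_contra hlt
    have := hzero r₀
    obtain rfl : c₀ = 0 := by omega
    omega
  have hbig : ∀ d, c₀ ≤ d → d ≤ c → i + 1 < T r d := by
    intro d hd
    induction d, hd using Nat.le_induction with
    | base =>
      intro _
      have h1 := hT.row_antitone (r := r) hc₀ hc (by omega)
      have h2 := hbelow r hr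
      have h3 := hcol r r₀ c₀ hr.ne (by omega) (by omega)
      omega
    | succ d hd ih =>
      intro hdc
      have h1 := ih (by omega)
      have h2 := hT.row_antitone (r := r₀) hc₀ hd
      have h3 := hT.row_antitone (r := r₀) (by omega : 1 ≤ d) (by omega : d ≤ c) (by omega)
      have h4 := hkey r r₀ d hr (by omega) (by omega)
      omega
  have := hbig c hc le_rfl
  omega

lemma swapCols_mem_SSKT {α φ : ℕ → ℕ} (hφ : IsFlag φ) {T : Tableau} (hT : T ∈ SSKT α φ) {i : ℕ}
    (hi : 1 ≤ i) {r₀ : ℤ} {c₀ : ℕ} (hq : T r₀ c₀ = i + 1) (hbelow : ∀ r < r₀, T r c₀ ≠ i)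
    (hprev : ∀ (r : ℤ) (c : ℕ), c + 1 = c₀ → r₀ < r → T r c ≠ i) :
    swapCols T i r₀ c₀ ∈ SSKT α φ := by
  obtain ⟨hK, hshape, hflag⟩ := hT
  have hlow : ∀ (r : ℤ) (c : ℕ), r < r₀ → c₀ ≤ c → T r₀ c = i + 1 → T r c ≠ i :=
    fun r c hr hc hrc => hK.ne_of_lt_row hi hq hbelow hr hc hrc
  have hK' := hK
  obtain ⟨hpos, hzero, hfin, hleft, hrow, hcol, hkey⟩ := hK'
  have hc₀ : 1 ≤ c₀ := by
    by_contra hlt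
    have := hzero r₀
    obtain rfl : c₀ = 0 := by omega
    omega
  have hr₀ : 1 ≤ r₀ := by
    by_contra hlt
    have := hpos r₀ c₀ (by omega)
    omega
  have hback : ∀ c, c₀ ≤ c → T r₀ (c + 1) = i + 1 → T r₀ c = i + 1 := by
    intro c hc h
    have h1 := hrow r₀ c (by omega) (by omega)
    have h2 := hK.row_antitone (r := r₀) hc₀ hc (by omega)
    omega
  have hnext : ∀ (r : ℤ) (c : ℕ), r₀ < r → c₀ ≤ c → T r₀ c = i + 1 → T r c = i →
      T r₀ (c + 1) = i + 1 := by
    intro r c hr hc h1 h2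
    have h3 := hkey r₀ r c hr (by omega) (by omega) (by omega)
    have h4 := hrow r₀ c (by omega) h3.1
    omega
  have hrowEq : ∀ (r : ℤ) (c : ℕ), T r₀ c = i + 1 → T r c = i + 1 → r = r₀ := by
    intro r c h1 h2
    by_contra hne
    exact hcol r r₀ c hne (by omega) (by omega) (by omega)
  have hnz := swapCols_ne_zero_iff (T := T) hi r₀ c₀
  refine ⟨⟨?_, ?_, ?_, ?_, ?_, ?_, ?_⟩, ?_, ?_⟩
  · intro r c hr
    by_contra h
    exact (hnz r c).1 h (hpos r c hr)
  · intro r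
    by_contra h
    exact (hnz r 0).1 h (hzero r)
  · simpa only [hnz] using hfin
  · intro r c hc h
    exact (hnz r c).2 (hleft r c hc ((hnz r (c + 1)).1 h))
  · intro r c hc h
    have h0 := (hnz r (c + 1)).1 h
    have h1 := hrow r c hc h0
    have h2 := hleft r c hc h0
    have e1 := hback c
    have e2 := hprev r c
    have e3 := hlow r (c + 1)
    have e4 := hrowEq r c
    have e5 := hrowEq r (c + 1)
    clear h hnz
    unfold swapCols
    rcases eq_or_ne r r₀ with rfl | hne
    · split_ifs <;> omega
    · split_ifs <;> omega
  · intro r r' c hne h1 h2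
    have h3 := hcol r r' c hne ((hnz r c).1 h1) ((hnz r' c).1 h2)
    clear h1 h2 hnz
    unfold swapCols
    split_ifs <;> omega
  · intro r r' c hlt h1 h2 h
    have h1 := (hnz r c).1 h1
    have h2 := (hnz r' c).1 h2
    refine (and_congr_left' (hnz r (c + 1))).2 ?_
    have e7 := hkey r r' c hlt h1 h2
    have e8 := hcol r r' c hlt.ne h1 h2
    unfold swapCols at h ⊢
    by_cases hP : c₀ ≤ c ∧ T r₀ c = i + 1
    · have e3 : T r c = i → r₀ < r := fun h3 => by
        rcases lt_trichotomy r r₀ with h4 | rfl | h4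
        · exact absurd h3 (hlow r c h4 hP.1 hP.2)
        · omega
        · exact h4
      have e3' : T r' c = i → T r₀ (c + 1) = i + 1 := fun h3 => by
        rcases lt_trichotomy r' r₀ with h4 | rfl | h4
        · exact absurd h3 (hlow r' c h4 hP.1 hP.2)
        · omega
        · exact hnext r' c h4 hP.1 hP.2 h3
      have e4' : T r' c = i + 1 → r' = r₀ := hrowEq r' c hP.2
      have e5 : T r₀ (c + 1) = i + 1 → T r (c + 1) = i + 1 → T r c = i + 1 := fun h3 h4 => by
        rw [hrowEq r (c + 1) h3 h4]
        exact hP.2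
      rw [if_pos hP, if_pos hP] at h
      by_cases hQ : c₀ ≤ c + 1 ∧ T r₀ (c + 1) = i + 1
      · rw [if_pos hQ]
        split_ifs at h ⊢ <;> omega
      · rw [if_neg hQ]
        split_ifs at h ⊢ <;> omega
    · rw [if_neg hP, if_neg hP] at h
      rw [if_neg hP]
      obtain ⟨e7, e7'⟩ := e7 h
      refine ⟨e7, ?_⟩
      by_cases hQ : c₀ ≤ c + 1 ∧ T r₀ (c + 1) = i + 1
      · have e1 : c + 1 = c₀ := by
          by_contra h3
          exact hP ⟨by omega, hback c (by omega) hQ.2⟩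
        have e2 : T r (c + 1) = i + 1 → T r' c ≠ i := fun h3 => by
          have := hrowEq r (c + 1) hQ.2 h3
          exact hprev r' c e1 (by omega)
        rw [if_pos hQ]
        split_ifs <;> omega
      · rwa [if_neg hQ]
  · rw [shapeOf_swapCols hi, hshape]
  · intro j c
    have h1 := hflag j c
    have h2 := hlow j c
    unfold swapCols
    split_ifs with ha hb hd
    · omega
    · have h3 : r₀ < (j : ℤ) := by
        by_contra hle
        rcases (not_lt.1 hle).lt_or_eq with h4 | h4
        · exact h2 h4 ha.1 ha.2 hd
        · rw [h4] at hb
          exact hb ha.2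
      lift r₀ to ℕ using by omega
      have h4 := hflag r₀ c
      have h5 := hφ.1 r₀ j (by omega) (by omega)
      omega
    · exact h1
    · exact h1

/-- The box selected by the raising operator: it has entry `i + 1`, no entry `i` occurs below it
in its column, nor above its row in the preceding column. -/
lemma entries_of_first_max {T : Tableau} (hT : IsKeyTableau T) {i : ℕ} (hi : 1 ≤ i) {r₀ : ℤ}
    {c₀ : ℕ} (hlt : ∀ (r : ℤ) (c : ℕ), (c < c₀ ∨ (c = c₀ ∧ r < r₀)) → mi T i r c < mi T i r₀ c₀) :
    T r₀ c₀ = i + 1 ∧ (∀ r < r₀, T r c₀ ≠ i) ∧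
      ∀ (r : ℤ) (c : ℕ), c + 1 = c₀ → r₀ < r → T r c ≠ i := by
  obtain ⟨hpos, hzero, hfin, hleft, hrow, hcol, hkey⟩ := hT
  have hf : ∀ v, 1 ≤ v → ∀ r c, (boxesUpTo T v r c).Finite := fun v hv r c =>
    finite_boxesUpTo hfin hv r c
  have hq : T r₀ c₀ = i + 1 := by
    by_contra hne
    have h := hlt (r₀ - 1) c₀ (Or.inr ⟨rfl, by omega⟩)
    rw [mi_eq_ncard_sub, mi_eq_ncard_sub] at h
    have h1 : (boxesUpTo T (i + 1) r₀ c₀).ncard ≤ (boxesUpTo T (i + 1) (r₀ - 1) c₀).ncard := by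
      refine Set.ncard_le_ncard ?_ (hf _ (by omega) _ _)
      rintro ⟨a, b⟩ ⟨h1, h2⟩
      refine ⟨h1, ?_⟩
      simp only at h1 h2 ⊢
      rcases h2 with h2 | ⟨rfl, h2⟩
      · exact Or.inl h2
      · rcases h2.lt_or_eq with h3 | rfl
        · right; omega
        · exact absurd h1 hne
    have h2 : (boxesUpTo T i (r₀ - 1) c₀).ncard ≤ (boxesUpTo T i r₀ c₀).ncard := by
      refine Set.ncard_le_ncard ?_ (hf _ hi _ _)
      rintro ⟨a, b⟩ ⟨h1, h2⟩
      refine ⟨h1, ?_⟩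
      simp only at h2 ⊢
      omega
    omega
  have hstep : ∀ (r : ℤ) (c : ℕ), (c < c₀ ∨ (c = c₀ ∧ r < r₀)) → T r c = i →
      (∀ (a : ℤ) (b : ℕ), T a b = i + 1 → (b < c₀ ∨ (b = c₀ ∧ a < r₀)) →
        (b < c ∨ (b = c ∧ a < r))) → False := by
    intro r c hp hrc hU
    have h := hlt (r - 1) c (by omega)
    rw [mi_eq_ncard_sub, mi_eq_ncard_sub] at h
    have h1 : (boxesUpTo T (i + 1) r₀ c₀).ncard ≤
        (boxesUpTo T (i + 1) (r - 1) c).ncard + 1 := by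
      refine (Set.ncard_le_ncard ?_ ((hf _ (by omega) _ _).insert (r₀, c₀))).trans
        (Set.ncard_insert_le _ _)
      rintro ⟨a, b⟩ ⟨h1, h2⟩
      simp only at h1 h2
      by_cases hab : (a, b) = (r₀, c₀)
      · exact Or.inl hab
      · rw [Prod.mk.injEq] at hab
        have := hU a b h1 (by omega)
        exact Or.inr ⟨h1, by simp only; omega⟩
    have h2 : (boxesUpTo T i (r - 1) c).ncard + 1 ≤ (boxesUpTo T i r₀ c₀).ncard := by
      rw [← Set.ncard_insert_of_notMem (a := (r, c)) ?_ (hf _ hi _ _)]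
      · refine Set.ncard_le_ncard ?_ (hf _ hi _ _)
        rintro ⟨a, b⟩ (h1 | ⟨h1, h2⟩)
        · rw [Prod.mk.injEq] at h1
          obtain ⟨rfl, rfl⟩ := h1
          exact ⟨hrc, by simp only; omega⟩
        · refine ⟨h1, ?_⟩
          simp only at h2 ⊢
          omega
      · rintro ⟨-, h2⟩
        simp only at h2
        omega
    omega
  refine ⟨hq, fun r hr h => ?_, fun r c hc hr h => ?_⟩
  · refine hstep r c₀ (Or.inr ⟨rfl, hr⟩) h fun a b hab hlt' => ?_
    rcases hlt' with h1 | ⟨rfl, h1⟩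
    · exact Or.inl h1
    · exact absurd (hab.trans hq.symm) (hcol a r₀ b h1.ne (by omega) (by omega))
  · subst hc
    refine hstep r c (Or.inl (by omega)) h fun a b hab hlt' => ?_
    have hc : 1 ≤ c := by
      by_contra hc
      have := hzero r
      obtain rfl : c = 0 := by omega
      omega
    rcases hlt' with h1 | ⟨rfl, h1⟩
    · rcases Nat.lt_succ_iff_lt_or_eq.1 h1 with h1 | rfl
      · exact Or.inl h1
      · right
        refine ⟨rfl, ?_⟩
        by_contra hle
        have h2 := hleft r₀ b hc (by omega)
        have h3 := hrow r₀ b hc (by omega)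
        have h4 := hcol r₀ a b (by omega) h2 (by omega)
        have h5 := hkey r₀ a b (by omega) h2 (by omega) (by omega)
        omega
    · exact absurd (hab.trans hq.symm) (hcol a r₀ _ h1.ne (by omega) (by omega))

/-- Proposition: `e_i` preserves `SSKT(α,φ)`.
For `T ∈ SSKT(α, φ)` and every positive integer `i`, the Assaf–Schilling raising operator
satisfies `e_i(T) ∈ SSKT(α, φ)` or `e_i(T) = 0`. -/
theorem keyE_preserves_SSKT (α : ℕ → ℕ) (hα : WeakComp α) (φ : ℕ → ℕ) (hφ : IsFlag φ)
    (T : Tableau) (hT : T ∈ SSKT α φ) (i : ℕ) (hi : 1 ≤ i) :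
    keyE i T = none ∨ ∃ T', keyE i T = some T' ∧ T' ∈ SSKT α φ := by
  by_cases h : ∃ (r : ℤ) (c : ℕ), isMaxBox T i r c ∧ 1 ≤ mi T i r c
  swap
  · left
    unfold keyE
    rw [dif_neg h]
  right
  refine ⟨swapCols T i ((sInf {m : ℕ | isMaxBox T i ((m : ℕ) : ℤ)
    (sInf {c : ℕ | ∃ r : ℤ, isMaxBox T i r c})} : ℕ) : ℤ)
    (sInf {c : ℕ | ∃ r : ℤ, isMaxBox T i r c}), ?_, ?_⟩
  · unfold keyE
    rw [dif_pos h]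
    rfl
  set c₀ := sInf {c : ℕ | ∃ r : ℤ, isMaxBox T i r c} with hc₀
  set r₀ := sInf {m : ℕ | isMaxBox T i ((m : ℕ) : ℤ) c₀} with hr₀
  have hK := hT.1
  obtain ⟨hpos, -, hfin, -⟩ := hK
  have hrow : ∀ (r : ℤ) (c : ℕ), isMaxBox T i r c → ∃ m : ℕ, (m : ℤ) = r := by
    intro r c hm
    have : 0 < r := by
      by_contra hle
      exact hm.1 (hpos r c (by omega))
    exact ⟨r.toNat, by omega⟩
  obtain ⟨r₁, c₁, hm₁, hge₁⟩ := h
  obtain ⟨r₂, hm₂⟩ : ∃ r : ℤ, isMaxBox T i r c₀ :=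
    Nat.sInf_mem (s := {c : ℕ | ∃ r : ℤ, isMaxBox T i r c}) ⟨c₁, r₁, hm₁⟩
  have hq : isMaxBox T i (r₀ : ℤ) c₀ := by
    obtain ⟨m, rfl⟩ := hrow r₂ c₀ hm₂
    exact Nat.sInf_mem (s := {m : ℕ | isMaxBox T i ((m : ℕ) : ℤ) c₀}) ⟨m, hm₂⟩
  have hge : 1 ≤ mi T i r₀ c₀ := hge₁.trans (hq.2 r₁ c₁ hm₁.1)
  obtain ⟨h1, h2, h3⟩ := entries_of_first_max hT.1 hi (r₀ := (r₀ : ℤ)) (c₀ := c₀) (by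
    intro r c hlt
    rcases mi_eq_zero_or_exists_box hfin hi r c with h0 | ⟨r', c', hne, hle, heq⟩
    · omega
    · rw [← heq]
      refine lt_of_le_of_ne (hq.2 r' c' hne) fun he => ?_
      have hm : isMaxBox T i r' c' := ⟨hne, by rw [he]; exact hq.2⟩
      obtain ⟨m, rfl⟩ := hrow r' c' hm
      have hc : c₀ ≤ c' := Nat.sInf_le ⟨_, hm⟩
      obtain rfl : c' = c₀ := by omega
      have hr : r₀ ≤ m := Nat.sInf_le hm
      omega)
  exact swapCols_mem_SSKT hφ hT hi h1 h2 h3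

end
end
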